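/- Let Ω•(A) be a complete calculus on a quantum principal bundle B = A^{coH} ⊆ A, with corresponding complete calculus Ω•(H) (the maximal prolongation of a bicovariant FODC) on H, and let τ•: Ω•(H)→Ω•(A)⊗_{Ω•(B)}Ω•(A) be the graded extension of the translation map. Then Ω•(B) = Ω•(A)^{coΩ•(H)} ⊆ Ω•(A) is a graded Hopf–Galois extension: the graded canonical map χ•: Ω•(A)⊗_{Ω•(B)}Ω•(A)→Ω•(A)⊗Ω•(H), ω⊗η ↦ ω∧η_{[0]}⊗η_{[1]}, is a bijection of graded vector spaces, with inverse ω⊗θ ↦ ω∧τ•(θ). -/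

import Mathlib

open TensorProduct

noncomputable section

namespace NCG

variable {k : Type*} [CommRing k]

/-! ## Coactions -/

section Coactions

variable {H : Type*} [AddCommMonoid H] [Module k H] [Coalgebra k H]
variable {M : Type*} [AddCommMonoid M] [Module k M]

/-- `ρ : M → M ⊗ H` is a (counital, coassociative) right `H`-coaction. -/
def IsRightCoaction (ρ : M →ₗ[k] M ⊗[k] H) : Prop :=
  (LinearMap.lTensor M (Coalgebra.counit (R := k) (A := H)) ∘ₗ ρ
      = (TensorProduct.mk k M k).flip 1) ∧
  ((TensorProduct.assoc k M H H).toLinearMap ∘ₗ LinearMap.rTensor H ρ ∘ₗ ρ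
      = LinearMap.lTensor M (Coalgebra.comul (R := k) (A := H)) ∘ₗ ρ)

/-- `lam : M → H ⊗ M` is a left `H`-coaction. -/
def IsLeftCoaction (lam : M →ₗ[k] H ⊗[k] M) : Prop :=
  (LinearMap.rTensor M (Coalgebra.counit (R := k) (A := H)) ∘ₗ lam
      = TensorProduct.mk k k M 1) ∧
  ((TensorProduct.assoc k H H M).symm.toLinearMap ∘ₗ LinearMap.lTensor H lam ∘ₗ lam
      = LinearMap.rTensor M (Coalgebra.comul (R := k) (A := H)) ∘ₗ lam)

end Coactions

/-! ## Comodule algebras, coinvariants, Hopf–Galois extensions -/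

section ComodAlg

variable (k) in
/-- A right `H`-comodule algebra structure on `A`: an algebra morphism
`ρ : A → A ⊗ H` which is a right `H`-coaction. -/
structure ComodAlg (H : Type*) [Ring H] [Bialgebra k H]
    (A : Type*) [Ring A] [Algebra k A] where
  ρ : A →ₐ[k] A ⊗[k] H
  coaction : IsRightCoaction (k := k) ρ.toLinearMap

variable {H : Type*} [Ring H] [Bialgebra k H]
variable {A : Type*} [Ring A] [Algebra k A]

/-- The coinvariant subalgebra `B = A^{co H}` (as a submodule). -/
def ComodAlg.coinv (S : ComodAlg k H A) : Submodule k A where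
  carrier := {a | S.ρ a = a ⊗ₜ[k] (1 : H)}
  add_mem' := by
    intro a b ha hb
    simp only [Set.mem_setOf_eq] at *
    rw [map_add, ha, hb, TensorProduct.add_tmul]
  zero_mem' := by simp
  smul_mem' := by
    intro c a ha
    simp only [Set.mem_setOf_eq] at *
    rw [map_smul, ha, TensorProduct.smul_tmul']

lemma ComodAlg.one_mem_coinv (S : ComodAlg k H A) : (1 : A) ∈ S.coinv := by
  show S.ρ 1 = _
  rw [map_one, Algebra.TensorProduct.one_def]

/-- The lift `χ' : A ⊗ A → A ⊗ H`, `a ⊗ a' ↦ (a ⊗ 1) · ρ(a') = a a'₍₀₎ ⊗ a'₍₁₎`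
of the canonical Hopf–Galois map. -/
def chiAux (S : ComodAlg k H A) : A ⊗[k] A →ₗ[k] A ⊗[k] H :=
  TensorProduct.lift
    ((LinearMap.mul k (A ⊗[k] H) ∘ₗ (TensorProduct.mk k A H).flip 1).compl₂ S.ρ.toLinearMap)

/-- The relations defining the balanced tensor product `A ⊗_B A` over a
subalgebra (submodule) `B ⊆ A`. -/
def balRel (B : Submodule k A) : Submodule k (A ⊗[k] A) :=
  Submodule.span k
    {x | ∃ (a a' : A) (b : B), x = (a * (b : A)) ⊗ₜ[k] a' - a ⊗ₜ[k] ((b : A) * a')}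

/-- The balanced tensor product `A ⊗_B A`. -/
abbrev TensorOver (B : Submodule k A) : Type _ := (A ⊗[k] A) ⧸ balRel B

/-- `B = A^{co H} ⊆ A` is a Hopf–Galois extension:  the canonical map
`χ : A ⊗_B A → A ⊗ H` is bijective, i.e. its lift `χ'` is surjective with
kernel exactly the balanced relations. -/
def ComodAlg.IsHopfGalois (S : ComodAlg k H A) : Prop :=
  Function.Surjective (chiAux S) ∧ LinearMap.ker (chiAux S) = balRel S.coinv

/-- The canonical Hopf–Galois map `χ : A ⊗_B A → A ⊗ H` on the balanced
tensor product. -/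
def chiQ (S : ComodAlg k H A) (h : balRel S.coinv ≤ LinearMap.ker (chiAux S)) :
    TensorOver S.coinv →ₗ[k] A ⊗[k] H :=
  Submodule.liftQ _ (chiAux S) h

end ComodAlg

section HopfGalois

variable {H : Type*} [Ring H] [HopfAlgebra k H]
variable {A : Type*} [Ring A] [Algebra k A]

/-- A strong connection (in the sense of Theorem 3.7): a linear map
`ℓ : H → A ⊗ A` satisfying the four identities characterising faithfully
flat Hopf–Galois extensions (principal comodule algebras). -/
def IsStrongConnection (S : ComodAlg k H A) (ℓ : H →ₗ[k] A ⊗[k] A) : Prop :=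
  ℓ 1 = 1 ⊗ₜ[k] 1 ∧
  chiAux S ∘ₗ ℓ = TensorProduct.mk k A H 1 ∧
  LinearMap.mul' k A ∘ₗ ℓ =
    Algebra.linearMap k A ∘ₗ Coalgebra.counit (R := k) (A := H) ∧
  LinearMap.lTensor A S.ρ.toLinearMap ∘ₗ ℓ =
    (TensorProduct.assoc k A A H).toLinearMap ∘ₗ LinearMap.rTensor H ℓ ∘ₗ
      Coalgebra.comul (R := k) (A := H) ∧
  LinearMap.rTensor A S.ρ.toLinearMap ∘ₗ ℓ =
    LinearMap.rTensor A (TensorProduct.comm k H A).toLinearMap ∘ₗ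
      (TensorProduct.assoc k H A A).symm.toLinearMap ∘ₗ
      TensorProduct.map (HopfAlgebra.antipode (R := k)) ℓ ∘ₗ
      Coalgebra.comul (R := k) (A := H)

/-- A quantum principal bundle: a faithfully flat Hopf–Galois extension
`B = A^{co H} ⊆ A`, encoded (following Theorem 3.7 = Th. 6.19/6.20 of
Brzeziński–Wisbauer/Hajac et al.) as a Hopf–Galois extension admitting a
strong connection. -/
def ComodAlg.IsQPB (S : ComodAlg k H A) : Prop :=
  S.IsHopfGalois ∧ ∃ ℓ : H →ₗ[k] A ⊗[k] A, IsStrongConnection S ℓ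

end HopfGalois

/-! ## Differential graded algebras and differential calculi -/

section DGA

variable (k) in
/-- A differential graded algebra: an `ℕ`-graded algebra `Ω` together with a
degree `1` differential squaring to zero and satisfying the graded Leibniz
rule. -/
structure DGA (Ω : Type*) [Ring Ω] [Algebra k Ω] where
  grading : ℕ → Submodule k Ω
  gradedAlgebra : GradedAlgebra grading
  d : Ω →ₗ[k] Ω
  d_mem : ∀ n, ∀ x ∈ grading n, d x ∈ grading (n + 1)
  d_d : ∀ x, d (d x) = 0
  leibniz : ∀ n, ∀ ω ∈ grading n, ∀ η,
    d (ω * η) = d ω * η + ((-1 : k) ^ n) • (ω * d η)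

variable {Ω : Type*} [Ring Ω] [Algebra k Ω]

/-- Projection onto the degree `n` component of a graded algebra. -/
def DGA.projN (C : DGA k Ω) (n : ℕ) : Ω →ₗ[k] Ω :=
  letI := C.gradedAlgebra
  (C.grading n).subtype ∘ₗ DirectSum.component k ℕ (fun i => ↥(C.grading i)) n ∘ₗ
    (DirectSum.decomposeLinearEquiv C.grading).toLinearMap

/-- The sign operator `ς` of a graded algebra, acting by `(-1)^n` in degree `n`. -/
def DGA.sign (C : DGA k Ω) : Ω →ₗ[k] Ω :=
  letI := C.gradedAlgebra
  (DirectSum.toModule k ℕ Ω fun n => ((-1 : k) ^ n) • (C.grading n).subtype) ∘ₗ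
    (DirectSum.decomposeLinearEquiv C.grading).toLinearMap

variable {Ξ : Type*} [Ring Ξ] [Algebra k Ξ]
variable {M : Type*} [AddCommGroup M] [Module k M]

/-- The graded (Koszul) braiding `Ξ ⊗ M → M ⊗ Ξ`, `θ ⊗ m ↦ (-1)^{|θ||m|} m ⊗ θ`,
where the sign on `M` is implemented by the sign operator `s`. -/
def gradedBraid (CN : DGA k Ξ) (s : M →ₗ[k] M) : Ξ ⊗[k] M →ₗ[k] M ⊗[k] Ξ :=
  letI := CN.gradedAlgebra
  TensorProduct.lift
    ((DirectSum.toModule k ℕ (M →ₗ[k] M ⊗[k] Ξ) fun j =>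
        (LinearMap.llcomp k M M (M ⊗[k] Ξ)).flip (s ^ j) ∘ₗ
          (TensorProduct.mk k M Ξ).flip ∘ₗ (CN.grading j).subtype) ∘ₗ
      (DirectSum.decomposeLinearEquiv CN.grading).toLinearMap)

/-- The multiplication of the graded (Koszul-signed) tensor product
`(m ⊗ θ)(m' ⊗ θ') = (-1)^{|θ||m'|} m m' ⊗ θ θ'`, for a (possibly non-unital
carrier) `M` with multiplication `mulM` and sign operator `sM`, and a graded
algebra `Ξ`. -/
def koszulMulGen (mulM : M ⊗[k] M →ₗ[k] M) (mulN : Ξ ⊗[k] Ξ →ₗ[k] Ξ)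
    (CN : DGA k Ξ) (sM : M →ₗ[k] M) :
    (M ⊗[k] Ξ) ⊗[k] (M ⊗[k] Ξ) →ₗ[k] M ⊗[k] Ξ :=
  TensorProduct.map mulM mulN ∘ₗ
    (TensorProduct.assoc k (M ⊗[k] M) Ξ Ξ).toLinearMap ∘ₗ
    LinearMap.rTensor Ξ
      ((TensorProduct.assoc k M M Ξ).symm.toLinearMap ∘ₗ
        LinearMap.lTensor M (gradedBraid CN sM) ∘ₗ
        (TensorProduct.assoc k M Ξ M).toLinearMap) ∘ₗ
    (TensorProduct.assoc k (M ⊗[k] Ξ) M Ξ).symm.toLinearMap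

/-- The Koszul multiplication on the tensor product of two graded algebras. -/
def koszulMul (CM : DGA k Ω) (CN : DGA k Ξ) :
    (Ω ⊗[k] Ξ) ⊗[k] (Ω ⊗[k] Ξ) →ₗ[k] Ω ⊗[k] Ξ :=
  koszulMulGen (LinearMap.mul' k Ω) (LinearMap.mul' k Ξ) CN CM.sign

/-- The tensor product differential `d_⊗ = d ⊗ 1 + ς ⊗ d'`. -/
def dTensorGen (dM : M →ₗ[k] M) (sM : M →ₗ[k] M) {N : Type*} [AddCommGroup N]
    [Module k N] (dN : N →ₗ[k] N) : M ⊗[k] N →ₗ[k] M ⊗[k] N :=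
  TensorProduct.map dM LinearMap.id + TensorProduct.map sM dN

/-- The grading of the tensor product of two graded modules. -/
def tensorGrading {N : Type*} [AddCommGroup N] [Module k N]
    (𝒜 : ℕ → Submodule k M) (ℬ : ℕ → Submodule k N) (n : ℕ) :
    Submodule k (M ⊗[k] N) :=
  ⨆ p : {p : ℕ × ℕ // p.1 + p.2 = n},
    LinearMap.range (TensorProduct.map (𝒜 p.1.1).subtype (ℬ p.1.2).subtype)

end DGA

section DiffCalc

variable (k) in
/-- A differential calculus on an algebra `A`: a differential graded algebra
`Ω` with degree-zero part `A` (embedded via `ι`), generated in degree zero. -/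
structure DiffCalc (A : Type*) [Ring A] [Algebra k A]
    (Ω : Type*) [Ring Ω] [Algebra k Ω] extends DGA k Ω where
  ι : A →ₐ[k] Ω
  ι_injective : Function.Injective ι
  range_ι : ∀ x, x ∈ grading 0 ↔ x ∈ Set.range ι
  generated : Algebra.adjoin k (Set.range ι ∪ ⇑d '' Set.range ι) = ⊤

variable {A : Type*} [Ring A] [Algebra k A]
variable {Ω : Type*} [Ring Ω] [Algebra k Ω]

lemma DiffCalc.ι_mem (C : DiffCalc k A Ω) (a : A) : C.ι a ∈ C.grading 0 :=
  (C.range_ι _).2 ⟨a, rfl⟩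

lemma DiffCalc.d_ι_mem (C : DiffCalc k A Ω) (a : A) : C.d (C.ι a) ∈ C.grading 1 := by
  simpa using C.d_mem 0 (C.ι a) (C.ι_mem a)

lemma DiffCalc.sandwich_mem (C : DiffCalc k A Ω) (a b : A) {x : Ω}
    (hx : x ∈ C.grading 1) : C.ι a * x * C.ι b ∈ C.grading 1 := by
  letI := C.gradedAlgebra
  have h1 : C.ι a * x ∈ C.grading (0 + 1) := SetLike.mul_mem_graded (C.ι_mem a) hx
  have h2 : C.ι a * x * C.ι b ∈ C.grading (0 + 1 + 0) :=
    SetLike.mul_mem_graded h1 (C.ι_mem b)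
  simpa using h2

/-- The degree-zero identification `A ≃ Ω⁰`. -/
def DiffCalc.iota0 (C : DiffCalc k A Ω) : A ≃ₗ[k] ↥(C.grading 0) :=
  LinearEquiv.ofBijective (LinearMap.codRestrict (C.grading 0) C.ι.toLinearMap C.ι_mem)
    ⟨fun a b hab => C.ι_injective (congrArg Subtype.val hab),
     fun y => by
      obtain ⟨a, ha⟩ := (C.range_ι ↑y).1 y.2
      exact ⟨a, Subtype.ext ha⟩⟩

/-- Projection `Ω → A` onto the degree-zero component. -/
def DiffCalc.proj0 (C : DiffCalc k A Ω) : Ω →ₗ[k] A :=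
  letI := C.gradedAlgebra
  C.iota0.symm.toLinearMap ∘ₗ DirectSum.component k ℕ (fun i => ↥(C.grading i)) 0 ∘ₗ
    (DirectSum.decomposeLinearEquiv C.grading).toLinearMap

end DiffCalc

/-! ## Covariant calculi -/

section Covariant

variable {H : Type*} [Ring H] [Bialgebra k H]
variable {A : Type*} [Ring A] [Algebra k A]
variable {Ω : Type*} [Ring Ω] [Algebra k Ω]

/-- The comultiplication of a bialgebra, as a comodule-algebra structure of
`H` over itself. -/
def comulComod (k : Type*) [CommRing k] (H : Type*) [Ring H] [Bialgebra k H] :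
    ComodAlg k H H where
  ρ := Bialgebra.comulAlgHom k H
  coaction := by
    constructor
    · exact Coalgebra.lTensor_counit_comp_comul
    · exact Coalgebra.coassoc

/-- A right `H`-covariant differential calculus on a comodule algebra `A`:
the coaction `ΔR` extends `ρ` multiplicatively, degree-wise, and commutes
with the differential. -/
def IsRightCovariant (S : ComodAlg k H A) (C : DiffCalc k A Ω)
    (ΔR : Ω →ₗ[k] Ω ⊗[k] H) : Prop :=
  IsRightCoaction (k := k) ΔR ∧
  ΔR 1 = 1 ∧ (∀ x y, ΔR (x * y) = ΔR x * ΔR y) ∧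
  (∀ n, ∀ x ∈ C.grading n,
    ΔR x ∈ LinearMap.range (LinearMap.rTensor H (C.grading n).subtype)) ∧
  ΔR ∘ₗ C.d = LinearMap.rTensor H C.d ∘ₗ ΔR ∧
  ΔR ∘ₗ C.ι.toLinearMap = LinearMap.rTensor H C.ι.toLinearMap ∘ₗ S.ρ.toLinearMap

/-- A left-covariant differential calculus on the Hopf algebra `H` itself:
the left coaction `ΛL` extends the comultiplication. -/
def IsLeftCovariantH (C : DiffCalc k H Ω) (ΛL : Ω →ₗ[k] H ⊗[k] Ω) : Prop :=
  IsLeftCoaction (k := k) ΛL ∧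
  ΛL 1 = 1 ∧ (∀ x y, ΛL (x * y) = ΛL x * ΛL y) ∧
  (∀ n, ∀ x ∈ C.grading n,
    ΛL x ∈ LinearMap.range (LinearMap.lTensor H (C.grading n).subtype)) ∧
  ΛL ∘ₗ C.d = LinearMap.lTensor H C.d ∘ₗ ΛL ∧
  ΛL ∘ₗ C.ι.toLinearMap =
    LinearMap.lTensor H C.ι.toLinearMap ∘ₗ Coalgebra.comul (R := k) (A := H)

/-- A bicovariant differential calculus on `H`: commuting right and left
covariant structures both extending the comultiplication. -/
def IsBicovariantH (C : DiffCalc k H Ω) (ΔR : Ω →ₗ[k] Ω ⊗[k] H)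
    (ΛL : Ω →ₗ[k] H ⊗[k] Ω) : Prop :=
  IsRightCovariant (comulComod k H) C ΔR ∧ IsLeftCovariantH C ΛL ∧
  LinearMap.rTensor H ΛL ∘ₗ ΔR =
    (TensorProduct.assoc k H Ω H).symm.toLinearMap ∘ₗ LinearMap.lTensor H ΔR ∘ₗ ΛL

/-- Left-coinvariant elements of a left comodule. -/
def leftCoinv {M : Type*} [AddCommGroup M] [Module k M]
    (lam : M →ₗ[k] H ⊗[k] M) : Submodule k M where
  carrier := {m | lam m = 1 ⊗ₜ[k] m}
  add_mem' := by
    intro a b ha hb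
    simp only [Set.mem_setOf_eq] at *
    rw [map_add, ha, hb, TensorProduct.tmul_add]
  zero_mem' := by simp
  smul_mem' := by
    intro c m hm
    simp only [Set.mem_setOf_eq] at *
    rw [map_smul, hm, TensorProduct.tmul_smul]

end Covariant

/-! ## Maximal prolongations -/

section MaxProl

universe u

variable {A : Type*} [Ring A] [Algebra k A]
variable {Ω : Type*} [Ring Ω] [Algebra k Ω]

/-- `g` identifies the first-order parts of the differential calculi `C` and
`C'` (as first order differential calculi over `A`). -/
def Matches1 {Ω' : Type*} [Ring Ω'] [Algebra k Ω'] (C : DiffCalc k A Ω)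
    (C' : DiffCalc k A Ω') (g : ↥(C.grading 1) →ₗ[k] Ω') : Prop :=
  (∀ x : C.grading 1, g x ∈ C'.grading 1) ∧
  Function.Injective g ∧
  (∀ y ∈ C'.grading 1, ∃ x, g x = y) ∧
  (∀ a : A, g ⟨C.d (C.ι a), C.d_ι_mem a⟩ = C'.d (C'.ι a)) ∧
  (∀ (a b : A) (x : C.grading 1),
    g ⟨C.ι a * ↑x * C.ι b, C.sandwich_mem a b x.2⟩ = C'.ι a * g x * C'.ι b)

/-- `C` is the maximal prolongation of its own first-order part: any other
differential calculus on `A` with the same first order is a quotient of `C`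
(universal property of the maximal prolongation). -/
def IsMaxProl (C : DiffCalc k A Ω) : Prop :=
  ∀ (Ω' : Type u) [Ring Ω'] [Algebra k Ω'], ∀ (C' : DiffCalc k A Ω')
    (g : ↥(C.grading 1) →ₗ[k] Ω'), Matches1 C C' g →
    ∃ Φ : Ω →ₐ[k] Ω',
      (∀ n, ∀ x ∈ C.grading n, Φ x ∈ C'.grading n) ∧
      (∀ x, Φ (C.d x) = C'.d (Φ x)) ∧
      (∀ a, Φ (C.ι a) = C'.ι a) ∧
      (∀ x : C.grading 1, Φ ↑x = g x)

end MaxProl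

/-! ## Complete calculi -/

section Complete

variable {H : Type*} [Ring H] [HopfAlgebra k H]
variable {A : Type*} [Ring A] [Algebra k A]
variable {ΩA : Type*} [Ring ΩA] [Algebra k ΩA]
variable {ΩH : Type*} [Ring ΩH] [Algebra k ΩH]

/-- `D` is an extension of the coaction `ρ : A → A ⊗ H` to a morphism of
differential graded algebras `Ω(A) → Ω(A) ⊗ Ω(H)` (Koszul signs built into
the target); i.e. the calculus `Ω(A)` is *complete* with extension `D`. -/
def IsCompleteExt (S : ComodAlg k H A) (CA : DiffCalc k A ΩA)
    (CH : DiffCalc k H ΩH) (D : ΩA →ₗ[k] ΩA ⊗[k] ΩH) : Prop :=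
  D 1 = 1 ⊗ₜ[k] 1 ∧
  (∀ x y, D (x * y) = koszulMul CA.toDGA CH.toDGA (D x ⊗ₜ[k] D y)) ∧
  D ∘ₗ CA.ι.toLinearMap =
    TensorProduct.map CA.ι.toLinearMap CH.ι.toLinearMap ∘ₗ S.ρ.toLinearMap ∧
  D ∘ₗ CA.d = dTensorGen CA.d CA.toDGA.sign CH.d ∘ₗ D ∧
  (∀ n, ∀ x ∈ CA.grading n, D x ∈ tensorGrading CA.grading CH.grading n)

/-- A complete calculus on the Hopf algebra `H` itself: the comultiplication
extends to a morphism of differential graded algebras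
`Ω(H) → Ω(H) ⊗ Ω(H)`. -/
def IsCompleteExtH (CH : DiffCalc k H ΩH) (D : ΩH →ₗ[k] ΩH ⊗[k] ΩH) : Prop :=
  IsCompleteExt (comulComod k H) CH CH D

/-- The graded counit `ε•` of a complete calculus on `H`: the counit in degree
zero and zero in positive degrees. -/
def epsBul (CH : DiffCalc k H ΩH) : ΩH →ₗ[k] k :=
  Coalgebra.counit (R := k) (A := H) ∘ₗ CH.proj0

end Complete

end NCG
namespace NCG

variable {k : Type*} [CommRing k]

/-! ## First order differential calculi -/

section FODC

variable (k) in
/-- A first order differential calculus `(Γ, d)` on `A`: an `A`-bimodule `Γ`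
(with explicit structure maps) together with a derivation `d : A → Γ`
generating `Γ`. -/
structure FODC (A : Type*) [Ring A] [Algebra k A]
    (Γ : Type*) [AddCommGroup Γ] [Module k Γ] where
  lsmul : A →ₗ[k] Γ →ₗ[k] Γ
  rsmul : A →ₗ[k] Γ →ₗ[k] Γ
  one_lsmul : ∀ x, lsmul 1 x = x
  one_rsmul : ∀ x, rsmul 1 x = x
  mul_lsmul : ∀ a b x, lsmul (a * b) x = lsmul a (lsmul b x)
  mul_rsmul : ∀ a b x, rsmul (a * b) x = rsmul b (rsmul a x)
  lsmul_rsmul : ∀ a b x, lsmul a (rsmul b x) = rsmul b (lsmul a x)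
  d : A →ₗ[k] Γ
  leibniz : ∀ a b, d (a * b) = lsmul a (d b) + rsmul b (d a)
  surj : Submodule.span k {x | ∃ a b, x = lsmul a (d b)} = ⊤

end FODC

/-! ## Diagonal actions on tensor products -/

section ActionHelpers

variable {A H Γ : Type*} [Ring A] [Algebra k A] [Ring H] [Algebra k H]
variable [AddCommGroup Γ] [Module k Γ]

/-- Left action of `A ⊗ H` on `Γ ⊗ H`: `(a ⊗ h) ⊳ (x ⊗ g) = (a ⊳ x) ⊗ h g`. -/
def lactTH (act : A →ₗ[k] Γ →ₗ[k] Γ) :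
    (A ⊗[k] H) →ₗ[k] (Γ ⊗[k] H) →ₗ[k] Γ ⊗[k] H :=
  TensorProduct.curry
    (TensorProduct.map (TensorProduct.lift act) (LinearMap.mul' k H) ∘ₗ
      (TensorProduct.tensorTensorTensorComm k A H Γ H).toLinearMap)

/-- Right action of `A ⊗ H` on `Γ ⊗ H`: `(x ⊗ g) ⊲ (a ⊗ h) = (x ⊲ a) ⊗ g h`. -/
def ractTH (act : A →ₗ[k] Γ →ₗ[k] Γ) :
    (A ⊗[k] H) →ₗ[k] (Γ ⊗[k] H) →ₗ[k] Γ ⊗[k] H :=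
  TensorProduct.curry
    (TensorProduct.map (TensorProduct.lift act)
        (LinearMap.mul' k H ∘ₗ (TensorProduct.comm k H H).toLinearMap) ∘ₗ
      (TensorProduct.tensorTensorTensorComm k A H Γ H).toLinearMap)

/-- Left action of `A ⊗ H` on `A ⊗ Γ`: `(a ⊗ h) ⊳ (c ⊗ x) = a c ⊗ (h ⊳ x)`. -/
def lactHT (act : H →ₗ[k] Γ →ₗ[k] Γ) :
    (A ⊗[k] H) →ₗ[k] (A ⊗[k] Γ) →ₗ[k] A ⊗[k] Γ :=
  TensorProduct.curry
    (TensorProduct.map (LinearMap.mul' k A) (TensorProduct.lift act) ∘ₗ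
      (TensorProduct.tensorTensorTensorComm k A H A Γ).toLinearMap)

/-- Right action of `A ⊗ H` on `A ⊗ Γ`: `(c ⊗ x) ⊲ (a ⊗ h) = c a ⊗ (x ⊲ h)`. -/
def ractHT (act : H →ₗ[k] Γ →ₗ[k] Γ) :
    (A ⊗[k] H) →ₗ[k] (A ⊗[k] Γ) →ₗ[k] A ⊗[k] Γ :=
  TensorProduct.curry
    (TensorProduct.map (LinearMap.mul' k A ∘ₗ (TensorProduct.comm k A A).toLinearMap)
        (TensorProduct.lift act) ∘ₗ
      (TensorProduct.tensorTensorTensorComm k A H A Γ).toLinearMap)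

end ActionHelpers

/-! ## Covariant first order calculi and first order extensions -/

section FODCCov

variable {H : Type*} [Ring H] [Bialgebra k H]
variable {A : Type*} [Ring A] [Algebra k A]
variable {Γ : Type*} [AddCommGroup Γ] [Module k Γ]
variable {ΓH : Type*} [AddCommGroup ΓH] [Module k ΓH]

/-- Right `H`-covariance of a FODC `(Γ, d)` on a comodule algebra `A`. -/
def FODC.IsRightCovariant (S : ComodAlg k H A) (C : FODC k A Γ)
    (ΔΓ : Γ →ₗ[k] Γ ⊗[k] H) : Prop :=
  IsRightCoaction (k := k) ΔΓ ∧
  (∀ a x, ΔΓ (C.lsmul a x) = lactTH C.lsmul (S.ρ a) (ΔΓ x)) ∧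
  (∀ a x, ΔΓ (C.rsmul a x) = ractTH C.rsmul (S.ρ a) (ΔΓ x)) ∧
  ΔΓ ∘ₗ C.d = LinearMap.rTensor H C.d ∘ₗ S.ρ.toLinearMap

/-- Left covariance of a FODC `(Γ, d)` on the Hopf algebra `H` itself. -/
def FODC.IsLeftCovariantH (C : FODC k H Γ) (ΛΓ : Γ →ₗ[k] H ⊗[k] Γ) : Prop :=
  IsLeftCoaction (k := k) ΛΓ ∧
  (∀ h x, ΛΓ (C.lsmul h x) =
    lactHT C.lsmul (Coalgebra.comul (R := k) (A := H) h) (ΛΓ x)) ∧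
  (∀ h x, ΛΓ (C.rsmul h x) =
    ractHT C.rsmul (Coalgebra.comul (R := k) (A := H) h) (ΛΓ x)) ∧
  ΛΓ ∘ₗ C.d = LinearMap.lTensor H C.d ∘ₗ Coalgebra.comul (R := k) (A := H)

/-- Bicovariance of a FODC on `H`: commuting right and left covariant
structures. -/
def FODC.IsBicovariantH (C : FODC k H Γ) (ΔΓ : Γ →ₗ[k] Γ ⊗[k] H)
    (ΛΓ : Γ →ₗ[k] H ⊗[k] Γ) : Prop :=
  FODC.IsRightCovariant (comulComod k H) C ΔΓ ∧ FODC.IsLeftCovariantH C ΛΓ ∧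
  LinearMap.rTensor H ΛΓ ∘ₗ ΔΓ =
    (TensorProduct.assoc k H Γ H).symm.toLinearMap ∘ₗ LinearMap.lTensor H ΔΓ ∘ₗ ΛΓ

/-- `D` is an extension of the coaction `ρ : A → A ⊗ H` to a morphism of first
order differential calculi `Γ_A → Ω¹(A ⊗ H) = (Γ_A ⊗ H) ⊕ (A ⊗ Γ_H)`, i.e.
a map covering `ρ`, `ρ`-bilinear and intertwining `d` with `d_⊗`. -/
def IsFirstOrderExt (S : ComodAlg k H A) (CA : FODC k A Γ) (CHf : FODC k H ΓH)
    (D : Γ →ₗ[k] (Γ ⊗[k] H) × (A ⊗[k] ΓH)) : Prop :=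
  (∀ a x, D (CA.lsmul a x) =
    (lactTH CA.lsmul (S.ρ a) (D x).1, lactHT CHf.lsmul (S.ρ a) (D x).2)) ∧
  (∀ a x, D (CA.rsmul a x) =
    (ractTH CA.rsmul (S.ρ a) (D x).1, ractHT CHf.rsmul (S.ρ a) (D x).2)) ∧
  D ∘ₗ CA.d =
    (LinearMap.rTensor H CA.d ∘ₗ S.ρ.toLinearMap).prod
      (LinearMap.lTensor A CHf.d ∘ₗ S.ρ.toLinearMap)

end FODCCov

/-! ## Vertical forms -/

section Vertical

variable {H : Type*} [Ring H] [HopfAlgebra k H]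
variable {A : Type*} [Ring A] [Algebra k A]
variable {ΩH : Type*} [Ring ΩH] [Algebra k ΩH]

/-- Two-sided multiplication `Ω ⊗ Ω →ₗ (Ω →ₗ Ω)`, `(x ⊗ z) ↦ (y ↦ x y z)`. -/
def bimul (Ω : Type*) [Ring Ω] [Algebra k Ω] : Ω ⊗[k] Ω →ₗ[k] Ω →ₗ[k] Ω :=
  TensorProduct.lift
    ((LinearMap.llcomp k Ω Ω Ω ∘ₗ LinearMap.mul k Ω).compl₂ (LinearMap.mul k Ω).flip)

/-- The right adjoint action `ω ↼ h = S(h₁) ω h₂` of `H` on forms `Ω(H)`. -/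
def adAct (CH : DiffCalc k H ΩH) : H →ₗ[k] ΩH →ₗ[k] ΩH :=
  bimul ΩH ∘ₗ
    TensorProduct.map (CH.ι.toLinearMap ∘ₗ HopfAlgebra.antipode (R := k))
      CH.ι.toLinearMap ∘ₗ
    Coalgebra.comul (R := k) (A := H)

/-- The Cartan–Maurer map `h ↦ ϖ(π_ε(h)) = S(h₁) d(h₂)`. -/
def cartan (CH : DiffCalc k H ΩH) : H →ₗ[k] ΩH :=
  LinearMap.mul' k ΩH ∘ₗ
    TensorProduct.map (CH.ι.toLinearMap ∘ₗ HopfAlgebra.antipode (R := k))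
      (CH.d ∘ₗ CH.ι.toLinearMap) ∘ₗ
    Coalgebra.comul (R := k) (A := H)

/-- The projection `π_Λ : ω ↦ S(ω₋₁) ω₀` onto left-coinvariant forms. -/
def piLam (CH : DiffCalc k H ΩH) (ΛL : ΩH →ₗ[k] H ⊗[k] ΩH) : ΩH →ₗ[k] ΩH :=
  LinearMap.mul' k ΩH ∘ₗ
    TensorProduct.map (CH.ι.toLinearMap ∘ₗ HopfAlgebra.antipode (R := k))
      LinearMap.id ∘ₗ ΛL

/-- The multiplication `(a ⊗ ϑ) ∧ (a' ⊗ ϑ') = a a'₍₀₎ ⊗ (ϑ ↼ a'₍₁₎) ∧ ϑ'` of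
vertical forms, as a map on the ambient space `A ⊗ Ω(H)`. -/
def verMul (S : ComodAlg k H A) (CH : DiffCalc k H ΩH) :
    (A ⊗[k] ΩH) ⊗[k] (A ⊗[k] ΩH) →ₗ[k] A ⊗[k] ΩH :=
  TensorProduct.map (LinearMap.mul' k A)
      (LinearMap.mul' k ΩH ∘ₗ
        LinearMap.rTensor ΩH (TensorProduct.lift (adAct CH).flip) ∘ₗ
        (TensorProduct.assoc k ΩH H ΩH).symm.toLinearMap) ∘ₗ
    (TensorProduct.tensorTensorTensorComm k A ΩH A (H ⊗[k] ΩH)).toLinearMap ∘ₗ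
    LinearMap.lTensor (A ⊗[k] ΩH)
      ((TensorProduct.assoc k A H ΩH).toLinearMap ∘ₗ
        LinearMap.rTensor ΩH S.ρ.toLinearMap)

/-- The vertical differential
`d_v(a ⊗ ϑ) = a ⊗ dϑ + a₍₀₎ ⊗ ϖ(π_ε(a₍₁₎)) ∧ ϑ`. -/
def verD (S : ComodAlg k H A) (CH : DiffCalc k H ΩH) :
    A ⊗[k] ΩH →ₗ[k] A ⊗[k] ΩH :=
  LinearMap.lTensor A CH.d +
    LinearMap.lTensor A
        (LinearMap.mul' k ΩH ∘ₗ LinearMap.rTensor ΩH (cartan CH)) ∘ₗ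
      (TensorProduct.assoc k A H ΩH).toLinearMap ∘ₗ
      LinearMap.rTensor ΩH S.ρ.toLinearMap

/-- The vertical forms `ver• = A ⊗ Λ•` as a submodule of `A ⊗ Ω(H)`. -/
def verSub (A : Type*) [Ring A] [Algebra k A] (ΛL : ΩH →ₗ[k] H ⊗[k] ΩH) :
    Submodule k (A ⊗[k] ΩH) :=
  LinearMap.range (LinearMap.lTensor A (leftCoinv ΛL).subtype)

/-- The degree-`n` vertical forms `ver^n = A ⊗ Λⁿ`. -/
def verSubN (A : Type*) [Ring A] [Algebra k A] (CH : DiffCalc k H ΩH)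
    (ΛL : ΩH →ₗ[k] H ⊗[k] ΩH) (n : ℕ) : Submodule k (A ⊗[k] ΩH) :=
  LinearMap.range (LinearMap.lTensor A ((leftCoinv ΛL ⊓ CH.grading n)).subtype)

end Vertical

/-! ## Quotient multiplications on balanced tensor products -/

section QuotMul

variable {A : Type*} [Ring A] [Algebra k A]

/-- Left multiplication (by `x`) on the first leg of `A ⊗ A`, followed by the
projection onto `A ⊗_B A`. -/
def lmulQaux (B : Submodule k A) (x : A) :
    A ⊗[k] A →ₗ[k] TensorOver (k := k) B :=
  (balRel B).mkQ ∘ₗ LinearMap.rTensor A (LinearMap.mul k A x)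

lemma lmulQaux_rel (B : Submodule k A) (x : A) :
    balRel (k := k) B ≤ LinearMap.ker (lmulQaux B x) := by
  refine Submodule.span_le.mpr ?_
  rintro z ⟨a, a', b, rfl⟩
  simp only [SetLike.mem_coe, LinearMap.mem_ker, lmulQaux, LinearMap.coe_comp,
    Function.comp_apply, map_sub, LinearMap.rTensor_tmul, LinearMap.mul_apply']
  rw [← map_sub, Submodule.mkQ_apply, Submodule.Quotient.mk_eq_zero]
  apply Submodule.subset_span
  exact ⟨x * a, a', b, by rw [mul_assoc]⟩

/-- Left multiplication on the first leg of `A ⊗_B A`. -/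
def lmulQ (B : Submodule k A) :
    A →ₗ[k] TensorOver (k := k) B →ₗ[k] TensorOver (k := k) B where
  toFun x := Submodule.liftQ _ (lmulQaux B x) (lmulQaux_rel B x)
  map_add' x y := by
    apply Submodule.linearMap_qext
    simp only [Submodule.liftQ_mkQ, LinearMap.add_comp, Submodule.liftQ_mkQ]
    simp only [lmulQaux, map_add, LinearMap.rTensor_add, LinearMap.comp_add]
  map_smul' c x := by
    apply Submodule.linearMap_qext
    simp only [RingHom.id_apply, Submodule.liftQ_mkQ, LinearMap.smul_comp,
      Submodule.liftQ_mkQ]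
    simp only [lmulQaux, map_smul, LinearMap.rTensor_smul, LinearMap.comp_smul]

/-- Right multiplication (by `x`) on the second leg of `A ⊗ A`, followed by
the projection onto `A ⊗_B A`. -/
def rmulQaux (B : Submodule k A) (x : A) :
    A ⊗[k] A →ₗ[k] TensorOver (k := k) B :=
  (balRel B).mkQ ∘ₗ LinearMap.lTensor A ((LinearMap.mul k A).flip x)

lemma rmulQaux_rel (B : Submodule k A) (x : A) :
    balRel (k := k) B ≤ LinearMap.ker (rmulQaux B x) := by
  refine Submodule.span_le.mpr ?_
  rintro z ⟨a, a', b, rfl⟩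
  simp only [SetLike.mem_coe, LinearMap.mem_ker, rmulQaux, LinearMap.coe_comp,
    Function.comp_apply, map_sub, LinearMap.lTensor_tmul, LinearMap.flip_apply,
    LinearMap.mul_apply']
  rw [← map_sub, Submodule.mkQ_apply, Submodule.Quotient.mk_eq_zero]
  apply Submodule.subset_span
  exact ⟨a, a' * x, b, by rw [mul_assoc]⟩

/-- Right multiplication on the second leg of `A ⊗_B A`. -/
def rmulQ (B : Submodule k A) :
    A →ₗ[k] TensorOver (k := k) B →ₗ[k] TensorOver (k := k) B where
  toFun x := Submodule.liftQ _ (rmulQaux B x) (rmulQaux_rel B x)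
  map_add' x y := by
    apply Submodule.linearMap_qext
    simp only [Submodule.liftQ_mkQ, LinearMap.add_comp, Submodule.liftQ_mkQ]
    simp only [rmulQaux, map_add, LinearMap.lTensor_add, LinearMap.comp_add]
  map_smul' c x := by
    apply Submodule.linearMap_qext
    simp only [RingHom.id_apply, Submodule.liftQ_mkQ, LinearMap.smul_comp,
      Submodule.liftQ_mkQ]
    simp only [rmulQaux, map_smul, LinearMap.lTensor_smul, LinearMap.comp_smul]

end QuotMul

/-! ## Base, horizontal and balanced graded forms -/

section GradedHG

variable {H : Type*} [Ring H] [HopfAlgebra k H]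
variable {A : Type*} [Ring A] [Algebra k A]
variable {ΩA : Type*} [Ring ΩA] [Algebra k ΩA]
variable {ΩH : Type*} [Ring ΩH] [Algebra k ΩH]

/-- The base forms `Ω•(B)`: forms invariant under the extended coaction. -/
def baseForms (D : ΩA →ₗ[k] ΩA ⊗[k] ΩH) : Submodule k ΩA where
  carrier := {ω | D ω = ω ⊗ₜ[k] 1}
  add_mem' := by
    intro a b ha hb
    simp only [Set.mem_setOf_eq] at *
    rw [map_add, ha, hb, TensorProduct.add_tmul]
  zero_mem' := by simp
  smul_mem' := by
    intro c a ha
    simp only [Set.mem_setOf_eq] at *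
    rw [map_smul, ha, TensorProduct.smul_tmul']

/-- The horizontal forms `hor• = (Δ_A•)⁻¹(Ω•(A) ⊗ H)`. -/
def horForms (CH : DiffCalc k H ΩH) (D : ΩA →ₗ[k] ΩA ⊗[k] ΩH) : Submodule k ΩA :=
  Submodule.comap D (LinearMap.range (LinearMap.lTensor ΩA CH.ι.toLinearMap))

/-- The lift `Ω(A) ⊗ Ω(A) → Ω(A) ⊗ Ω(H)`, `ω ⊗ η ↦ (ω ∧ η₍₀₎) ⊗ η₍₁₎` of the
graded canonical Hopf–Galois map. -/
def chiBulAux (D : ΩA →ₗ[k] ΩA ⊗[k] ΩH) : ΩA ⊗[k] ΩA →ₗ[k] ΩA ⊗[k] ΩH :=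
  LinearMap.rTensor ΩH (LinearMap.mul' k ΩA) ∘ₗ
    (TensorProduct.assoc k ΩA ΩA ΩH).symm.toLinearMap ∘ₗ LinearMap.lTensor ΩA D

end GradedHG

end NCG
namespace NCG

variable {k : Type*} [CommRing k]

section YDHelpers

variable {H : Type*} [Ring H] [HopfAlgebra k H]
variable {ΩH : Type*} [Ring ΩH] [Algebra k ΩH]

/-- `h ↦ h₂ ⊗ (h₁ ⊗ h₃)`. -/
def comul13 : H →ₗ[k] H ⊗[k] (H ⊗[k] H) :=
  (TensorProduct.assoc k H H H).toLinearMap ∘ₗ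
    LinearMap.rTensor H (TensorProduct.comm k H H).toLinearMap ∘ₗ
    (TensorProduct.assoc k H H H).symm.toLinearMap ∘ₗ
    LinearMap.lTensor H (Coalgebra.comul (R := k) (A := H)) ∘ₗ
    Coalgebra.comul (R := k) (A := H)

/-- The sandwich action `(g ⊗ g') ↦ (ω ↦ ι(S(g)) ω ι(g'))`. -/
def sandwich (CH : DiffCalc k H ΩH) : H ⊗[k] H →ₗ[k] ΩH →ₗ[k] ΩH :=
  bimul ΩH ∘ₗ
    TensorProduct.map (CH.ι.toLinearMap ∘ₗ HopfAlgebra.antipode (R := k))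
      CH.ι.toLinearMap

/-- The right hand side `(ϑ₍₁₎ ↼ h₂) ⊗ S(h₁) ϑ₍₂₎ h₃` of the Yetter–Drinfel'd
compatibility condition, evaluated on `t = ϑ₍₁₎ ⊗ ϑ₍₂₎`. -/
def ydRHS (CH : DiffCalc k H ΩH) (h : H) (t : ΩH ⊗[k] ΩH) : ΩH ⊗[k] ΩH :=
  (TensorProduct.map (TensorProduct.lift (adAct CH))
      (TensorProduct.lift (sandwich CH)) ∘ₗ
    (TensorProduct.tensorTensorTensorComm k H (H ⊗[k] H) ΩH ΩH).toLinearMap)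
    (comul13 (k := k) h ⊗ₜ[k] t)

/-- The canonical extension `Δ•_bc` of the comultiplication to a bicovariant
calculus: `Δ` on degree `0` and `Δ_R + _ΩΔ` in positive degrees. -/
def deltaBc (CH : DiffCalc k H ΩH) (ΔR : ΩH →ₗ[k] ΩH ⊗[k] H)
    (ΛL : ΩH →ₗ[k] H ⊗[k] ΩH) : ΩH →ₗ[k] ΩH ⊗[k] ΩH :=
  TensorProduct.map CH.ι.toLinearMap CH.ι.toLinearMap ∘ₗ
      Coalgebra.comul (R := k) (A := H) ∘ₗ CH.proj0 +
    (TensorProduct.map LinearMap.id CH.ι.toLinearMap ∘ₗ ΔR +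
        TensorProduct.map CH.ι.toLinearMap LinearMap.id ∘ₗ ΛL) ∘ₗ
      (LinearMap.id - CH.ι.toLinearMap ∘ₗ CH.proj0)

/-- The map `Ξ : ω ↦ ω₋₂ ⊗ S(ω₋₁) ω₀` from `Ω•(H)` to `H ⊗ Λ•`. -/
def XiMap (CH : DiffCalc k H ΩH) (ΛL : ΩH →ₗ[k] H ⊗[k] ΩH) :
    ΩH →ₗ[k] H ⊗[k] ΩH :=
  LinearMap.lTensor H (piLam CH ΛL) ∘ₗ ΛL

/-- The multiplication map `μ : h ⊗ ϑ ↦ ι(h) ϑ`. -/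
def muMap (CH : DiffCalc k H ΩH) : H ⊗[k] ΩH →ₗ[k] ΩH :=
  LinearMap.mul' k ΩH ∘ₗ TensorProduct.map CH.ι.toLinearMap LinearMap.id

end YDHelpers

end NCG
namespace NCG

section S17defs

variable {k : Type*} [CommRing k]
variable {H : Type*} [Ring H] [HopfAlgebra k H]
variable {A : Type*} [Ring A] [Algebra k A]
variable {ΩA : Type*} [Ring ΩA] [Algebra k ΩA]
variable {ΩH : Type*} [Ring ΩH] [Algebra k ΩH]

/-- The degree-one formula for the graded translation map: for lifts
`w = h⟨1⟩ ⊗ h⟨2⟩` and `v = g⟨1⟩ ⊗ g⟨2⟩` of `τ(h)` and `τ(g)`, the element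
`d(g⟨1⟩) h⟨1⟩ ⊗_{Ω(B)} h⟨2⟩ g⟨2⟩ + g⟨1⟩ h⟨1⟩ ⊗_{Ω(B)} h⟨2⟩ d(g⟨2⟩)`. -/
def tauOneFormula (CA : DiffCalc k A ΩA) (DA : ΩA →ₗ[k] ΩA ⊗[k] ΩH) :
    (A ⊗[k] A) ⊗[k] (A ⊗[k] A) →ₗ[k] TensorOver (k := k) (baseForms DA) :=
  (balRel (baseForms DA)).mkQ ∘ₗ
    (TensorProduct.map
        (LinearMap.mul' k ΩA ∘ₗ
          TensorProduct.map (CA.d ∘ₗ CA.ι.toLinearMap) CA.ι.toLinearMap ∘ₗ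
          (TensorProduct.comm k A A).toLinearMap)
        (LinearMap.mul' k ΩA ∘ₗ
          TensorProduct.map CA.ι.toLinearMap CA.ι.toLinearMap) +
      TensorProduct.map
        (LinearMap.mul' k ΩA ∘ₗ
          TensorProduct.map CA.ι.toLinearMap CA.ι.toLinearMap ∘ₗ
          (TensorProduct.comm k A A).toLinearMap)
        (LinearMap.mul' k ΩA ∘ₗ
          TensorProduct.map CA.ι.toLinearMap (CA.d ∘ₗ CA.ι.toLinearMap))) ∘ₗ
    (TensorProduct.tensorTensorTensorComm k A A A A).toLinearMap

end S17defs

section Grading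

variable {k : Type*} [CommRing k] {Ω : Type*} [Ring Ω] [Algebra k Ω] (C : DGA k Ω)

lemma DGA.projN_mem (n : ℕ) (x : Ω) : C.projN n x ∈ C.grading n := by
  simp only [DGA.projN, LinearMap.comp_apply]
  exact Subtype.property _

lemma DGA.projN_eq (n : ℕ) (x : Ω) : 
    C.projN n x = letI := C.gradedAlgebra; (DirectSum.decompose C.grading x n : Ω) := rfl

variable {C} in
lemma DGA.projN_of_mem {n : ℕ} {x : Ω} (hx : x ∈ C.grading n) : C.projN n x = x := by
  let := C.gradedAlgebra
  rw [C.projN_eq]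
  exact DirectSum.decompose_of_mem_same _ hx

variable {C} in
lemma DGA.projN_of_mem_ne {m n : ℕ} {x : Ω} (hx : x ∈ C.grading m) (h : m ≠ n) :
    C.projN n x = 0 := by
  let := C.gradedAlgebra
  rw [C.projN_eq]
  exact DirectSum.decompose_of_mem_ne _ hx h

variable {C} in
lemma DGA.homogeneous_induction {p : Ω → Prop} (zero : p 0)
    (hom : ∀ n, ∀ x ∈ C.grading n, p x) (add : ∀ x y, p x → p y → p (x + y)) (x : Ω) : p x := by
  let := C.gradedAlgebra
  exact DirectSum.Decomposition.inductionOn C.grading zero (fun {i} m => hom i m m.2)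
    (fun m m' => add m m') x

variable {C} in
lemma DGA.mul_mem {m n : ℕ} {x y : Ω} (hx : x ∈ C.grading m) (hy : y ∈ C.grading n) :
    x * y ∈ C.grading (m + n) :=
  let := C.gradedAlgebra
  SetLike.mul_mem_graded hx hy

lemma DGA.one_mem : (1 : Ω) ∈ C.grading 0 :=
  let := C.gradedAlgebra
  SetLike.one_mem_graded C.grading

lemma DGA.projN_mul_right {i : ℕ} {y : Ω} (hy : y ∈ C.grading i) (n : ℕ) (x : Ω) :
    C.projN (n + i) (x * y) = C.projN n x * y := by
  induction x using C.homogeneous_induction with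
  | zero => simp
  | add x x' h h' => simp only [add_mul, map_add, h, h']
  | hom m x hx =>
    by_cases h : m = n
    · subst h
      rw [DGA.projN_of_mem hx, DGA.projN_of_mem (DGA.mul_mem hx hy)]
    · rw [DGA.projN_of_mem_ne hx h, DGA.projN_of_mem_ne (DGA.mul_mem hx hy) (by omega), zero_mul]

lemma DGA.projN_mul_right_of_lt {i : ℕ} {y : Ω} (hy : y ∈ C.grading i) {n : ℕ} (hn : n < i)
    (x : Ω) : C.projN n (x * y) = 0 := by
  induction x using C.homogeneous_induction with
  | zero => simp
  | add x x' h h' => simp only [add_mul, map_add, h, h', add_zero]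
  | hom m x hx => exact DGA.projN_of_mem_ne (DGA.mul_mem hx hy) (by omega)

lemma DGA.projN_mul_left {y : Ω} (hy : y ∈ C.grading 0) (n : ℕ) (x : Ω) :
    C.projN n (y * x) = y * C.projN n x := by
  induction x using C.homogeneous_induction with
  | zero => simp
  | add x x' h h' => simp only [mul_add, map_add, h, h']
  | hom m x hx =>
    have hm : y * x ∈ C.grading m := by simpa using DGA.mul_mem hy hx
    by_cases h : m = n
    · subst h
      rw [DGA.projN_of_mem hx, DGA.projN_of_mem hm]
    · rw [DGA.projN_of_mem_ne hx h, DGA.projN_of_mem_ne hm h, mul_zero]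

variable {C} in
lemma DGA.sign_of_mem {n : ℕ} {x : Ω} (hx : x ∈ C.grading n) :
    C.sign x = ((-1 : k) ^ n) • x := by
  let := C.gradedAlgebra
  lift x to C.grading n using hx
  simp [DGA.sign, DirectSum.toModule_lof]

lemma DGA.projN_sign (n : ℕ) (x : Ω) :
    C.projN n (C.sign x) = ((-1 : k) ^ n) • C.projN n x := by
  induction x using C.homogeneous_induction with
  | zero => simp
  | add x x' h h' => simp only [smul_add, map_add, h, h']
  | hom m x hx =>
    rw [DGA.sign_of_mem hx, map_smul]
    by_cases h : m = n
    · subst h; rfl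
    · rw [DGA.projN_of_mem_ne hx h, smul_zero, smul_zero]

variable {Ξ : Type*} [Ring Ξ] [Algebra k Ξ] (CN : DGA k Ξ)

variable {CN} in
lemma gradedBraid_tmul {M : Type*} [AddCommGroup M] [Module k M] (s : M →ₗ[k] M) {j : ℕ} {θ : Ξ}
    (hθ : θ ∈ CN.grading j) (m : M) : gradedBraid CN s (θ ⊗ₜ m) = (s ^ j) m ⊗ₜ θ := by
  let := CN.gradedAlgebra
  lift θ to CN.grading j using hθ
  simp [gradedBraid, DirectSum.toModule_lof]

variable {C CN} in
lemma koszulMul_tmul {j : ℕ} {θ : Ξ} (hθ : θ ∈ CN.grading j) (x y : Ω) (θ' : Ξ) :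
    koszulMul C CN ((x ⊗ₜ θ) ⊗ₜ (y ⊗ₜ θ')) = (x * (C.sign ^ j) y) ⊗ₜ (θ * θ') := by
  simp [koszulMul, koszulMulGen, gradedBraid_tmul _ hθ]

end Grading

section DegreeFiltration

variable {k : Type*} [CommRing k] {Ξ : Type*} [Ring Ξ] [Algebra k Ξ] (C : DGA k Ξ)

lemma DGA.exists_sum_projN (x : Ξ) :
    ∃ N, ∀ m ≥ N, ∑ j ∈ Finset.range m, C.projN j x = x := by
  induction x using C.homogeneous_induction with
  | zero => exact ⟨0, fun m _ => by simp⟩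
  | add x x' h h' =>
    obtain ⟨N, h⟩ := h
    obtain ⟨N', h'⟩ := h'
    refine ⟨max N N', fun m hm => ?_⟩
    simp only [map_add, Finset.sum_add_distrib, h m (by omega), h' m (by omega)]
  | hom n x hx =>
    refine ⟨n + 1, fun m hm => ?_⟩
    rw [Finset.sum_eq_single n, DGA.projN_of_mem hx]
    · exact fun j _ hj => DGA.projN_of_mem_ne hx hj.symm
    · intro h
      simp at h
      omega

variable {M : Type*} [AddCommGroup M] [Module k M]

lemma exists_sum_lTensor_projN (t : M ⊗[k] Ξ) :
    ∃ N, ∀ m ≥ N, ∑ j ∈ Finset.range m, LinearMap.lTensor M (C.projN j) t = t := by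
  induction t with
  | zero => exact ⟨0, fun m _ => by simp⟩
  | add x x' h h' =>
    obtain ⟨N, h⟩ := h
    obtain ⟨N', h'⟩ := h'
    refine ⟨max N N', fun m hm => ?_⟩
    simp only [map_add, Finset.sum_add_distrib, h m (by omega), h' m (by omega)]
  | tmul a x =>
    obtain ⟨N, h⟩ := C.exists_sum_projN x
    exact ⟨N, fun m hm => by simp only [LinearMap.lTensor_tmul, ← tmul_sum, h m hm]⟩

lemma DGA.projN_projN (i j : ℕ) (x : Ξ) :
    C.projN j (C.projN i x) = if i = j then C.projN i x else 0 := by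
  split_ifs with h
  · subst h; exact DGA.projN_of_mem (C.projN_mem _ _)
  · exact DGA.projN_of_mem_ne (C.projN_mem _ _) h

lemma lTensor_projN_projN (i j : ℕ) (t : M ⊗[k] Ξ) :
    LinearMap.lTensor M (C.projN j) (LinearMap.lTensor M (C.projN i) t) =
      if i = j then LinearMap.lTensor M (C.projN i) t else 0 := by
  rw [← LinearMap.comp_apply, ← LinearMap.lTensor_comp]
  split_ifs with h
  · congr 2; ext x; simp [DGA.projN_projN, h]
  · have : C.projN j ∘ₗ C.projN i = 0 := by ext x; simp [DGA.projN_projN, h]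
    simp [this]

variable (M) in
/-- Elements of `M ⊗ Ξ` whose second leg has only components of degree less than `n`. -/
def degreeLT (n : ℕ) : Submodule k (M ⊗[k] Ξ) :=
  ⨅ j ∈ Set.Ici n, LinearMap.ker (LinearMap.lTensor M (C.projN j))

variable {C}

lemma mem_degreeLT {n : ℕ} {t : M ⊗[k] Ξ} :
    t ∈ degreeLT C M n ↔ ∀ j, n ≤ j → LinearMap.lTensor M (C.projN j) t = 0 := by
  simp [degreeLT]

lemma degreeLT_mono {m n : ℕ} (h : m ≤ n) : degreeLT C M m ≤ degreeLT C M n :=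
  fun _ ht => mem_degreeLT.2 fun j hj => mem_degreeLT.1 ht j (h.trans hj)

lemma eq_zero_of_mem_degreeLT_zero {t : M ⊗[k] Ξ} (ht : t ∈ degreeLT C M 0) : t = 0 := by
  obtain ⟨N, h⟩ := exists_sum_lTensor_projN C t
  rw [← h N le_rfl]
  exact Finset.sum_eq_zero fun j _ => mem_degreeLT.1 ht j (Nat.zero_le j)

lemma lTensor_projN_mem_degreeLT {j n : ℕ} (h : j < n) (t : M ⊗[k] Ξ) :
    LinearMap.lTensor M (C.projN j) t ∈ degreeLT C M n :=
  mem_degreeLT.2 fun i hi => by rw [lTensor_projN_projN, if_neg (by omega)]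

lemma exists_mem_degreeLT (t : M ⊗[k] Ξ) : ∃ n, t ∈ degreeLT C M n := by
  obtain ⟨N, h⟩ := exists_sum_lTensor_projN C t
  refine ⟨N, ?_⟩
  rw [← h N le_rfl]
  exact Submodule.sum_mem _ fun j hj => lTensor_projN_mem_degreeLT (Finset.mem_range.1 hj) t

lemma sub_lTensor_projN_mem_degreeLT {n : ℕ} {t : M ⊗[k] Ξ} (ht : t ∈ degreeLT C M (n + 1)) :
    t - LinearMap.lTensor M (C.projN n) t ∈ degreeLT C M n := by
  refine mem_degreeLT.2 fun j hj => ?_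
  rw [map_sub, lTensor_projN_projN]
  split_ifs with h
  · rw [h, sub_self]
  · rw [mem_degreeLT.1 ht j (by omega), sub_zero]

lemma lTensor_sign_mem_degreeLT {n : ℕ} {t : M ⊗[k] Ξ} (ht : t ∈ degreeLT C M n) :
    LinearMap.lTensor M C.sign t ∈ degreeLT C M n := by
  refine mem_degreeLT.2 fun j hj => ?_
  have h : C.projN j ∘ₗ C.sign = ((-1 : k) ^ j) • C.projN j := by
    ext x; simp [DGA.projN_sign]
  rw [← LinearMap.comp_apply, ← LinearMap.lTensor_comp, h, LinearMap.lTensor_smul,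
    LinearMap.smul_apply, mem_degreeLT.1 ht j hj, smul_zero]

lemma degreeLT_le {P : Submodule k (M ⊗[k] Ξ)} {n : ℕ}
    (h : ∀ j < n, ∀ m : M, ∀ x ∈ C.grading j, m ⊗ₜ x ∈ P) : degreeLT C M n ≤ P := by
  intro t ht
  obtain ⟨N, hN⟩ := exists_sum_lTensor_projN C t
  rw [← hN N le_rfl]
  refine Submodule.sum_mem _ fun j _ => ?_
  by_cases hj : j < n
  · clear hN ht
    induction t with
    | zero => simp
    | add t t' ht ht' => rw [map_add]; exact add_mem ht ht'
    | tmul m x => exact h j hj m _ (C.projN_mem j x)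
  · rw [mem_degreeLT.1 ht j (by omega)]
    exact zero_mem _

variable {Ω : Type*} [Ring Ω] [Algebra k Ω]
variable {N N' : Type*} [AddCommGroup N] [Module k N] [AddCommGroup N'] [Module k N']

lemma lTensor_projN_mul_map {i : ℕ} {g : N' →ₗ[k] Ξ} (hg : ∀ x, g x ∈ C.grading i)
    (f : N →ₗ[k] Ω) (n : ℕ) (t : Ω ⊗[k] Ξ) (u : N ⊗[k] N') :
    LinearMap.lTensor Ω (C.projN (n + i)) (t * TensorProduct.map f g u) =
      LinearMap.lTensor Ω (C.projN n) t * TensorProduct.map f g u := by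
  induction u with
  | zero => simp
  | add u u' h h' => simp only [map_add, mul_add, h, h']
  | tmul a b =>
    induction t with
    | zero => simp
    | add t t' h h' => simp only [map_add, add_mul, h, h']
    | tmul x y => simp [C.projN_mul_right (hg b)]

lemma mul_map_mem_degreeLT {i : ℕ} {g : N' →ₗ[k] Ξ} (hg : ∀ x, g x ∈ C.grading i)
    (f : N →ₗ[k] Ω) {n : ℕ} {t : Ω ⊗[k] Ξ} (ht : t ∈ degreeLT C Ω n) (u : N ⊗[k] N') :
    t * TensorProduct.map f g u ∈ degreeLT C Ω (n + i) := by
  refine mem_degreeLT.2 fun j hj => ?_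
  obtain ⟨m, rfl⟩ := Nat.exists_eq_add_of_le hj
  rw [show n + i + m = n + m + i by omega, lTensor_projN_mul_map hg,
    mem_degreeLT.1 ht _ (by omega), zero_mul]

lemma tmul_mul_mem_degreeLT {y : Ξ} (hy : y ∈ C.grading 0) (x : Ω) {n : ℕ} {t : Ω ⊗[k] Ξ}
    (ht : t ∈ degreeLT C Ω n) : (x ⊗ₜ[k] y) * t ∈ degreeLT C Ω n := by
  refine mem_degreeLT.2 fun j hj => ?_
  have h : LinearMap.lTensor Ω (C.projN j) ((x ⊗ₜ[k] y) * t) =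
      (x ⊗ₜ[k] y) * LinearMap.lTensor Ω (C.projN j) t := by
    clear ht
    induction t with
    | zero => simp
    | add t t' h h' => simp only [map_add, mul_add, h, h']
    | tmul x' y' => simp [C.projN_mul_left hy]
  rw [h, mem_degreeLT.1 ht j hj, mul_zero]

end DegreeFiltration

section DiffCalcInduction

variable {k : Type*} [CommRing k] {A : Type*} [Ring A] [Algebra k A]
variable {Ω : Type*} [Ring Ω] [Algebra k Ω] (C : DiffCalc k A Ω)

lemma DiffCalc.right_induction (P : Submodule k Ω) (one : 1 ∈ P)
    (mul_ι : ∀ x ∈ P, ∀ a, x * C.ι a ∈ P) (mul_d : ∀ x ∈ P, ∀ a, x * C.d (C.ι a) ∈ P) (x : Ω) :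
    x ∈ P := by
  have hx : x ∈ Algebra.adjoin k (Set.range C.ι ∪ ⇑C.d '' Set.range C.ι) := by
    rw [C.generated]; trivial
  rw [← Subalgebra.mem_toSubmodule, Algebra.adjoin_eq_span] at hx
  refine Submodule.span_le.2 (fun y hy => ?_) hx
  induction hy using Submonoid.closure_induction_right with
  | one => exact one
  | mul_right y hy z hz ih =>
    rcases hz with ⟨a, rfl⟩ | ⟨_, ⟨a, rfl⟩, rfl⟩
    · exact mul_ι y ih a
    · exact mul_d y ih a

lemma DiffCalc.graded_right_induction (P : ℕ → Submodule k Ω) (one : 1 ∈ P 0)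
    (mul_ι : ∀ n, ∀ x ∈ P n, ∀ a, x * C.ι a ∈ P n)
    (mul_d : ∀ n, ∀ x ∈ P n, ∀ a, x * C.d (C.ι a) ∈ P (n + 1)) (n : ℕ) :
    C.grading n ≤ P n := by
  intro x hx
  suffices h : x ∈ ⨅ n, (P n).comap (C.projN n) by
    have := (Submodule.mem_iInf _).1 h n
    rwa [Submodule.mem_comap, DGA.projN_of_mem hx] at this
  clear hx
  refine C.right_induction _ ?_ (fun x hx a => ?_) (fun x hx a => ?_) x
  · refine (Submodule.mem_iInf _).2 fun n => Submodule.mem_comap.2 ?_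
    by_cases h : 0 = n
    · subst h
      rwa [DGA.projN_of_mem C.one_mem]
    · rw [DGA.projN_of_mem_ne C.one_mem h]
      exact zero_mem _
  · refine (Submodule.mem_iInf _).2 fun n => Submodule.mem_comap.2 ?_
    have := C.projN_mul_right (C.ι_mem a) n x
    rw [add_zero] at this
    rw [this]
    exact mul_ι n _ ((Submodule.mem_iInf _).1 hx n) a
  · refine (Submodule.mem_iInf _).2 fun n => Submodule.mem_comap.2 ?_
    rcases n with _ | n
    · rw [C.projN_mul_right_of_lt (C.d_ι_mem a) zero_lt_one]
      exact zero_mem _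
    · rw [C.projN_mul_right (C.d_ι_mem a)]
      exact mul_d n _ ((Submodule.mem_iInf _).1 hx n) a

end DiffCalcInduction

section Koszul

variable {k : Type*} [CommRing k]
variable {Ω : Type*} [Ring Ω] [Algebra k Ω] {CM : DGA k Ω}
variable {Ξ : Type*} [Ring Ξ] [Algebra k Ξ] {CN : DGA k Ξ}
variable {N N' : Type*} [AddCommGroup N] [Module k N] [AddCommGroup N'] [Module k N']

lemma DGA.sign_pow_of_mem {i : ℕ} {y : Ω} (hy : y ∈ CM.grading i) (j : ℕ) :
    (CM.sign ^ j) y = ((-1 : k) ^ (i * j)) • y := by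
  induction j with
  | zero => simp
  | succ j ih =>
    rw [pow_succ', Module.End.mul_apply, ih, map_smul, DGA.sign_of_mem hy, smul_smul, ← pow_add,
      mul_add, mul_one]

lemma koszulMul_map_of_zero {f : N →ₗ[k] Ω} (hf : ∀ x, f x ∈ CM.grading 0) (g : N' →ₗ[k] Ξ)
    (t : Ω ⊗[k] Ξ) (u : N ⊗[k] N') :
    koszulMul CM CN (t ⊗ₜ TensorProduct.map f g u) = t * TensorProduct.map f g u := by
  induction u with
  | zero => simp
  | add u u' h h' => simp only [map_add, tmul_add, mul_add, h, h']
  | tmul a b =>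
    induction t with
    | zero => simp
    | add t t' h h' => simp only [map_add, add_tmul, add_mul, h, h']
    | tmul x y =>
      induction y using CN.homogeneous_induction with
      | zero => simp
      | add y y' h h' => simp only [map_add, tmul_add, add_tmul, add_mul, h, h']
      | hom n y hy => simp [koszulMul_tmul hy, DGA.sign_pow_of_mem (hf a)]

lemma koszulMul_map_of_one {f : N →ₗ[k] Ω} (hf : ∀ x, f x ∈ CM.grading 1) (g : N' →ₗ[k] Ξ)
    (t : Ω ⊗[k] Ξ) (u : N ⊗[k] N') :
    koszulMul CM CN (t ⊗ₜ TensorProduct.map f g u) =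
      LinearMap.lTensor Ω CN.sign t * TensorProduct.map f g u := by
  induction u with
  | zero => simp
  | add u u' h h' => simp only [map_add, tmul_add, mul_add, h, h']
  | tmul a b =>
    induction t with
    | zero => simp
    | add t t' h h' => simp only [map_add, add_tmul, add_mul, h, h']
    | tmul x y =>
      induction y using CN.homogeneous_induction with
      | zero => simp
      | add y y' h h' => simp only [map_add, tmul_add, add_tmul, add_mul, h, h']
      | hom n y hy =>
        simp [koszulMul_tmul hy, DGA.sign_pow_of_mem (hf a), DGA.sign_of_mem hy, tmul_smul,
          smul_tmul']

lemma koszulMul_left_of_zero {g : N' →ₗ[k] Ξ} (hg : ∀ x, g x ∈ CN.grading 0) (f : N →ₗ[k] Ω)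
    (t : Ω ⊗[k] Ξ) (u : N ⊗[k] N') :
    koszulMul CM CN (TensorProduct.map f g u ⊗ₜ t) = TensorProduct.map f g u * t := by
  induction u with
  | zero => simp
  | add u u' h h' => simp only [map_add, add_tmul, add_mul, h, h']
  | tmul a b =>
    induction t with
    | zero => simp
    | add t t' h h' => simp only [tmul_add, map_add, mul_add, h, h']
    | tmul x y => simp [koszulMul_tmul (hg b)]

end Koszul

section CompleteExt

variable {k : Type*} [CommRing k] {H : Type*} [Ring H] [HopfAlgebra k H]
variable {A : Type*} [Ring A] [Algebra k A] {S : ComodAlg k H A}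
variable {ΩH : Type*} [Ring ΩH] [Algebra k ΩH] {CH : DiffCalc k H ΩH}
variable {ΩA : Type*} [Ring ΩA] [Algebra k ΩA] {CA : DiffCalc k A ΩA}
variable {D : ΩA →ₗ[k] ΩA ⊗[k] ΩH} (hD : IsCompleteExt S CA CH D)
include hD

lemma IsCompleteExt.map_ι (a : A) :
    D (CA.ι a) = TensorProduct.map CA.ι.toLinearMap CH.ι.toLinearMap (S.ρ a) :=
  LinearMap.congr_fun hD.2.2.1 a

lemma IsCompleteExt.mul_ι (x : ΩA) (a : A) :
    D (x * CA.ι a) = D x * TensorProduct.map CA.ι.toLinearMap CH.ι.toLinearMap (S.ρ a) := by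
  rw [hD.2.1, hD.map_ι, koszulMul_map_of_zero CA.ι_mem]

lemma IsCompleteExt.ι_mul (a : A) (x : ΩA) :
    D (CA.ι a * x) = TensorProduct.map CA.ι.toLinearMap CH.ι.toLinearMap (S.ρ a) * D x := by
  rw [hD.2.1, hD.map_ι, koszulMul_left_of_zero CH.ι_mem]

lemma IsCompleteExt.map_d_ι (a : A) :
    D (CA.d (CA.ι a)) =
      TensorProduct.map (CA.d ∘ₗ CA.ι.toLinearMap) CH.ι.toLinearMap (S.ρ a) +
        TensorProduct.map CA.ι.toLinearMap (CH.d ∘ₗ CH.ι.toLinearMap) (S.ρ a) := by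
  have h := LinearMap.congr_fun hD.2.2.2.1 (CA.ι a)
  rw [LinearMap.comp_apply, LinearMap.comp_apply, hD.map_ι] at h
  rw [h]
  induction S.ρ a with
  | zero => simp
  | add u u' h h' => simp only [map_add, h, h']; abel
  | tmul a b => simp [dTensorGen, DGA.sign_of_mem (CA.ι_mem a)]

lemma IsCompleteExt.mul_d_ι (x : ΩA) (a : A) :
    D (x * CA.d (CA.ι a)) =
      LinearMap.lTensor ΩA CH.sign (D x) *
          TensorProduct.map (CA.d ∘ₗ CA.ι.toLinearMap) CH.ι.toLinearMap (S.ρ a) +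
        D x * TensorProduct.map CA.ι.toLinearMap (CH.d ∘ₗ CH.ι.toLinearMap) (S.ρ a) := by
  rw [hD.2.1, hD.map_d_ι, tmul_add, map_add, koszulMul_map_of_one CA.d_ι_mem,
    koszulMul_map_of_zero CA.ι_mem]

lemma IsCompleteExt.baseForms_mul {b : ΩA} (hb : b ∈ baseForms D) (x : ΩA) :
    D (b * x) = (b ⊗ₜ 1) * D x := by
  have hb' : D b = TensorProduct.map LinearMap.id CH.ι.toLinearMap (b ⊗ₜ[k] (1 : H)) := by
    simpa using show D b = b ⊗ₜ 1 from hb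
  rw [hD.2.1, hb', koszulMul_left_of_zero CH.ι_mem]
  simp

lemma IsCompleteExt.balRel_le_ker : balRel (baseForms D) ≤ LinearMap.ker (chiBulAux D) := by
  refine Submodule.span_le.2 ?_
  rintro _ ⟨a, a', b, rfl⟩
  rw [SetLike.mem_coe, LinearMap.mem_ker, map_sub, sub_eq_zero]
  simp only [chiBulAux, LinearMap.comp_apply, LinearMap.lTensor_tmul, hD.baseForms_mul b.2]
  induction D a' with
  | zero => simp
  | add u u' h h' => simp only [map_add, tmul_add, mul_add, h, h']
  | tmul x y => simp [mul_assoc]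

end CompleteExt

section Counit

variable {k : Type*} [CommRing k] {H : Type*} [Ring H] [HopfAlgebra k H]
variable {ΩH : Type*} [Ring ΩH] [Algebra k ΩH] (CH : DiffCalc k H ΩH)

lemma DiffCalc.ι_proj0 (x : ΩH) : CH.ι (CH.proj0 x) = CH.projN 0 x := by
  have h : ∀ y, CH.ι (CH.iota0.symm y) = y := fun y =>
    congrArg Subtype.val (CH.iota0.apply_symm_apply y)
  exact h _

lemma epsBul_one : epsBul CH 1 = 1 := by
  have h : CH.proj0 1 = 1 := CH.ι_injective <| by
    rw [CH.ι_proj0, DGA.projN_of_mem CH.one_mem, map_one]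
  simp [epsBul, h]

lemma epsBul_mul_ι (x : ΩH) (h : H) :
    epsBul CH (x * CH.ι h) = epsBul CH x * Coalgebra.counit (R := k) h := by
  have h : CH.proj0 (x * CH.ι h) = CH.proj0 x * h := CH.ι_injective <| by
    rw [CH.ι_proj0, map_mul CH.ι, CH.ι_proj0]
    exact CH.projN_mul_right (CH.ι_mem h) 0 x
  simp [epsBul, h]

lemma epsBul_mul_d_ι (x : ΩH) (h : H) : epsBul CH (x * CH.d (CH.ι h)) = 0 := by
  have h : CH.proj0 (x * CH.d (CH.ι h)) = 0 := CH.ι_injective <| by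
    rw [CH.ι_proj0, map_zero]
    exact CH.projN_mul_right_of_lt (CH.d_ι_mem h) zero_lt_one x
  simp [epsBul, h]

lemma epsBul_sign (x : ΩH) : epsBul CH (CH.sign x) = epsBul CH x := by
  have h : CH.proj0 (CH.sign x) = CH.proj0 x := CH.ι_injective <| by
    rw [CH.ι_proj0, CH.ι_proj0, DGA.projN_sign]
    simp
  simp [epsBul, h]

variable (ΩA : Type*) [Ring ΩA] [Algebra k ΩA]

/-- The map `id ⊗ ε•`. -/
def counitRight : ΩA ⊗[k] ΩH →ₗ[k] ΩA :=
  (TensorProduct.rid k ΩA).toLinearMap ∘ₗ LinearMap.lTensor ΩA (epsBul CH)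

variable {ΩA}
variable {A : Type*} [AddCommGroup A] [Module k A]

lemma counitRight_mul_map_ι (f : A →ₗ[k] ΩA) (t : ΩA ⊗[k] ΩH) (u : A ⊗[k] H) :
    counitRight CH ΩA (t * TensorProduct.map f CH.ι.toLinearMap u) =
      counitRight CH ΩA t *
        f (TensorProduct.rid k A (LinearMap.lTensor A (Coalgebra.counit (R := k)) u)) := by
  induction u with
  | zero => simp
  | add u u' h h' => simp only [map_add, mul_add, h, h']
  | tmul a b =>
    induction t with
    | zero => simp
    | add t t' h h' => simp only [map_add, add_mul, h, h']
    | tmul x y => simp [counitRight, epsBul_mul_ι, smul_smul, mul_comm]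

lemma counitRight_mul_map_d_ι (f : A →ₗ[k] ΩA) (t : ΩA ⊗[k] ΩH) (u : A ⊗[k] H) :
    counitRight CH ΩA (t * TensorProduct.map f (CH.d ∘ₗ CH.ι.toLinearMap) u) = 0 := by
  induction u with
  | zero => simp
  | add u u' h h' => simp only [map_add, mul_add, h, h', add_zero]
  | tmul a b =>
    induction t with
    | zero => simp
    | add t t' h h' => simp only [map_add, add_mul, h, h', add_zero]
    | tmul x y => simp [counitRight, epsBul_mul_d_ι]

lemma counitRight_lTensor_sign (t : ΩA ⊗[k] ΩH) :
    counitRight CH ΩA (LinearMap.lTensor ΩA CH.sign t) = counitRight CH ΩA t := by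
  induction t with
  | zero => simp
  | add t t' h h' => simp only [map_add, h, h']
  | tmul x y => simp [counitRight, epsBul_sign]

end Counit

section CompleteExt

variable {k : Type*} [CommRing k] {H : Type*} [Ring H] [HopfAlgebra k H]
variable {A : Type*} [Ring A] [Algebra k A] {S : ComodAlg k H A}
variable {ΩH : Type*} [Ring ΩH] [Algebra k ΩH] {CH : DiffCalc k H ΩH}
variable {ΩA : Type*} [Ring ΩA] [Algebra k ΩA] {CA : DiffCalc k A ΩA}
variable {D : ΩA →ₗ[k] ΩA ⊗[k] ΩH} 

omit [Ring ΩA] [Algebra k ΩA] [Ring ΩH] [Algebra k ΩH] in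
lemma ComodAlg.rid_counit (S : ComodAlg k H A) (a : A) :
    TensorProduct.rid k A (LinearMap.lTensor A (Coalgebra.counit (R := k)) (S.ρ a)) = a := by
  have h := LinearMap.congr_fun S.coaction.1 a
  simp only [LinearMap.comp_apply, AlgHom.toLinearMap_apply, LinearMap.flip_apply,
    TensorProduct.mk_apply] at h
  rw [h, TensorProduct.rid_tmul, one_smul]

lemma IsCompleteExt.counitRight_apply (hD : IsCompleteExt S CA CH D) (x : ΩA) :
    counitRight CH ΩA (D x) = x := by
  refine CA.right_induction (LinearMap.ker (counitRight CH ΩA ∘ₗ D - LinearMap.id)) ?_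
    (fun x hx a => ?_) (fun x hx a => ?_) x |> fun h => by simpa [sub_eq_zero] using h
  · simp [hD.1, counitRight, epsBul_one]
  · simp only [LinearMap.mem_ker, LinearMap.sub_apply, LinearMap.comp_apply, LinearMap.id_apply,
      sub_eq_zero] at hx ⊢
    rw [hD.mul_ι, counitRight_mul_map_ι, hx, S.rid_counit]
    rfl
  · simp only [LinearMap.mem_ker, LinearMap.sub_apply, LinearMap.comp_apply, LinearMap.id_apply,
      sub_eq_zero] at hx ⊢
    rw [hD.mul_d_ι, map_add, counitRight_mul_map_ι, counitRight_mul_map_d_ι,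
      counitRight_lTensor_sign, hx, S.rid_counit, add_zero]
    rfl

lemma IsCompleteExt.injective (hD : IsCompleteExt S CA CH D) : Function.Injective D :=
  Function.LeftInverse.injective hD.counitRight_apply

lemma map_sign_sign_of_mem {CA : DGA k ΩA} {CH : DGA k ΩH} {n : ℕ} {t : ΩA ⊗[k] ΩH}
    (ht : t ∈ tensorGrading CA.grading CH.grading n) :
    TensorProduct.map CA.sign CH.sign t = ((-1 : k) ^ n) • t := by
  suffices h : tensorGrading CA.grading CH.grading n ≤
      LinearMap.ker (TensorProduct.map CA.sign CH.sign - ((-1 : k) ^ n) • LinearMap.id) by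
    simpa [sub_eq_zero] using h ht
  refine iSup_le fun p => ?_
  rintro _ ⟨u, rfl⟩
  induction u with
  | zero => simp
  | add u u' h h' => rw [map_add]; exact add_mem h h'
  | tmul x y =>
    simp [DGA.sign_of_mem x.2, DGA.sign_of_mem y.2, tmul_smul, smul_tmul', smul_smul,
      ← p.2, pow_add, mul_comm]

lemma IsCompleteExt.sign (hD : IsCompleteExt S CA CH D) (x : ΩA) :
    D (CA.sign x) = TensorProduct.map CA.sign CH.sign (D x) := by
  induction x using CA.homogeneous_induction with
  | zero => simp
  | add x x' h h' => simp only [map_add, h, h']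
  | hom n x hx => rw [DGA.sign_of_mem hx, map_smul, map_sign_sign_of_mem (hD.2.2.2.2 n x hx)]

end CompleteExt

section Assoc

variable {k : Type*} [CommRing k]
variable {X Y Z : Type*} [Ring X] [Algebra k X] [Ring Y] [Algebra k Y] [Ring Z] [Algebra k Z]

lemma assoc_mul (s t : (X ⊗[k] Y) ⊗[k] Z) :
    TensorProduct.assoc k X Y Z (s * t) =
      TensorProduct.assoc k X Y Z s * TensorProduct.assoc k X Y Z t :=
  map_mul (Algebra.TensorProduct.assoc k k k X Y Z) s t

end Assoc

section Coassoc

variable {k : Type*} [CommRing k] {H : Type*} [Ring H] [HopfAlgebra k H]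
variable {A : Type*} [Ring A] [Algebra k A] {S : ComodAlg k H A}
variable {ΩH : Type*} [Ring ΩH] [Algebra k ΩH] {CH : DiffCalc k H ΩH}
variable {ΩA : Type*} [Ring ΩA] [Algebra k ΩA] {CA : DiffCalc k A ΩA}
variable {D : ΩA →ₗ[k] ΩA ⊗[k] ΩH} {N : Type*} [AddCommGroup N] [Module k N]

lemma IsCompleteExt.rTensor_mul_map_ι (hD : IsCompleteExt S CA CH D) (g : H →ₗ[k] ΩH)
    (t : ΩA ⊗[k] ΩH) (u : A ⊗[k] H) :
    LinearMap.rTensor ΩH D (t * TensorProduct.map CA.ι.toLinearMap g u) =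
      LinearMap.rTensor ΩH D t *
        TensorProduct.map (TensorProduct.map CA.ι.toLinearMap CH.ι.toLinearMap) g
          (LinearMap.rTensor H S.ρ.toLinearMap u) := by
  induction u with
  | zero => simp
  | add u u' h h' => simp only [map_add, mul_add, h, h']
  | tmul a b =>
    induction t with
    | zero => simp
    | add t t' h h' => simp only [map_add, add_mul, h, h']
    | tmul x y => simp [hD.mul_ι]

lemma IsCompleteExt.rTensor_mul_map_d_ι (hD : IsCompleteExt S CA CH D) (g : H →ₗ[k] ΩH)
    (t : ΩA ⊗[k] ΩH) (u : A ⊗[k] H) :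
    LinearMap.rTensor ΩH D (t * TensorProduct.map (CA.d ∘ₗ CA.ι.toLinearMap) g u) =
      LinearMap.rTensor ΩH (LinearMap.lTensor ΩA CH.sign ∘ₗ D) t *
          TensorProduct.map (TensorProduct.map (CA.d ∘ₗ CA.ι.toLinearMap) CH.ι.toLinearMap) g
            (LinearMap.rTensor H S.ρ.toLinearMap u) +
        LinearMap.rTensor ΩH D t *
          TensorProduct.map (TensorProduct.map CA.ι.toLinearMap (CH.d ∘ₗ CH.ι.toLinearMap)) g
            (LinearMap.rTensor H S.ρ.toLinearMap u) := by
  induction u with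
  | zero => simp
  | add u u' h h' => simp only [map_add, mul_add, h, h']; abel
  | tmul a b =>
    induction t with
    | zero => simp
    | add t t' h h' => simp only [map_add, add_mul, h, h']; abel
    | tmul x y => simp [hD.mul_d_ι, add_tmul]

variable {X : Type*} [Ring X] [Algebra k X]

lemma IsCompleteExt.lTensor_mul_map_ι (hD : IsCompleteExt S CA CH D) (f : N →ₗ[k] X)
    (t : X ⊗[k] ΩA) (u : N ⊗[k] A) :
    LinearMap.lTensor X D (t * TensorProduct.map f CA.ι.toLinearMap u) =
      LinearMap.lTensor X D t *
        TensorProduct.map f (TensorProduct.map CA.ι.toLinearMap CH.ι.toLinearMap)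
          (LinearMap.lTensor N S.ρ.toLinearMap u) := by
  induction u with
  | zero => simp
  | add u u' h h' => simp only [map_add, mul_add, h, h']
  | tmul a b =>
    induction t with
    | zero => simp
    | add t t' h h' => simp only [map_add, add_mul, h, h']
    | tmul x y => simp [hD.mul_ι]

lemma IsCompleteExt.lTensor_mul_map_d_ι (hD : IsCompleteExt S CA CH D) (f : N →ₗ[k] X)
    (t : X ⊗[k] ΩA) (u : N ⊗[k] A) :
    LinearMap.lTensor X D (t * TensorProduct.map f (CA.d ∘ₗ CA.ι.toLinearMap) u) =
      LinearMap.lTensor X (LinearMap.lTensor ΩA CH.sign ∘ₗ D) t *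
          TensorProduct.map f (TensorProduct.map (CA.d ∘ₗ CA.ι.toLinearMap) CH.ι.toLinearMap)
            (LinearMap.lTensor N S.ρ.toLinearMap u) +
        LinearMap.lTensor X D t *
          TensorProduct.map f (TensorProduct.map CA.ι.toLinearMap (CH.d ∘ₗ CH.ι.toLinearMap))
            (LinearMap.lTensor N S.ρ.toLinearMap u) := by
  induction u with
  | zero => simp
  | add u u' h h' => simp only [map_add, mul_add, h, h']; abel
  | tmul a b =>
    induction t with
    | zero => simp
    | add t t' h h' => simp only [map_add, add_mul, h, h']; abel
    | tmul x y => simp [hD.mul_d_ι, tmul_add]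

lemma ComodAlg.assoc_rTensor (S : ComodAlg k H A) (a : A) :
    TensorProduct.assoc k A H H (LinearMap.rTensor H S.ρ.toLinearMap (S.ρ a)) =
      LinearMap.lTensor A (comulComod k H).ρ.toLinearMap (S.ρ a) :=
  LinearMap.congr_fun S.coaction.2 a

lemma assoc_map {P Q R P' Q' R' : Type*} [AddCommGroup P] [Module k P] [AddCommGroup Q] [Module k Q]
    [AddCommGroup R] [Module k R] [AddCommGroup P'] [Module k P'] [AddCommGroup Q'] [Module k Q']
    [AddCommGroup R'] [Module k R'] (f : P →ₗ[k] P') (g : Q →ₗ[k] Q') (h : R →ₗ[k] R')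
    (t : (P ⊗[k] Q) ⊗[k] R) :
    TensorProduct.assoc k P' Q' R' (TensorProduct.map (TensorProduct.map f g) h t) =
      TensorProduct.map f (TensorProduct.map g h) (TensorProduct.assoc k P Q R t) :=
  TensorProduct.map_map_assoc .. |>.symm

lemma IsCompleteExt.coassoc (hD : IsCompleteExt S CA CH D) {DH : ΩH →ₗ[k] ΩH ⊗[k] ΩH}
    (hDH : IsCompleteExtH CH DH) (x : ΩA) :
    TensorProduct.assoc k ΩA ΩH ΩH (LinearMap.rTensor ΩH D (D x)) =
      LinearMap.lTensor ΩA DH (D x) := by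
  refine CA.right_induction (LinearMap.ker ((TensorProduct.assoc k ΩA ΩH ΩH).toLinearMap ∘ₗ
    LinearMap.rTensor ΩH D ∘ₗ D - LinearMap.lTensor ΩA DH ∘ₗ D)) ?_
    (fun x hx a => ?_) (fun x hx a => ?_) x |> fun h => by simpa [sub_eq_zero] using h
  · simp [hD.1, hDH.1]
  · simp only [LinearMap.mem_ker, LinearMap.sub_apply, LinearMap.comp_apply, sub_eq_zero,
      LinearEquiv.coe_coe] at hx ⊢
    rw [hD.mul_ι, hD.rTensor_mul_map_ι, hDH.lTensor_mul_map_ι, assoc_mul, hx, assoc_map,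
      S.assoc_rTensor]
  · simp only [LinearMap.mem_ker, LinearMap.sub_apply, LinearMap.comp_apply, sub_eq_zero,
      LinearEquiv.coe_coe] at hx ⊢
    have e1 : TensorProduct.assoc k ΩA ΩH ΩH
        (LinearMap.rTensor ΩH D (LinearMap.lTensor ΩA CH.sign (D x))) =
        LinearMap.lTensor ΩA (LinearMap.lTensor ΩH CH.sign ∘ₗ DH) (D x) := by
      rw [LinearMap.lTensor_comp, LinearMap.comp_apply, ← hx]
      generalize D x = t
      induction t with
      | zero => simp
      | add t t' h h' => simp only [map_add, h, h']
      | tmul x y =>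
        simp only [LinearMap.lTensor_tmul, LinearMap.rTensor_tmul]
        induction D x with
        | zero => simp
        | add t t' h h' => simp only [map_add, add_tmul, h, h']
        | tmul x y => simp
    have e2 : TensorProduct.assoc k ΩA ΩH ΩH
        (LinearMap.rTensor ΩH (LinearMap.lTensor ΩA CH.sign ∘ₗ D)
          (LinearMap.lTensor ΩA CH.sign (D x))) =
        LinearMap.lTensor ΩA DH (LinearMap.lTensor ΩA CH.sign (D x)) := by
      rw [← LinearMap.comp_apply (LinearMap.lTensor ΩA DH), ← LinearMap.lTensor_comp,
        show DH ∘ₗ CH.sign = TensorProduct.map CH.sign CH.sign ∘ₗ DH from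
          LinearMap.ext hDH.sign, LinearMap.lTensor_comp, LinearMap.comp_apply, ← hx]
      generalize D x = t
      induction t with
      | zero => simp
      | add t t' h h' => simp only [map_add, h, h']
      | tmul x y =>
        simp only [LinearMap.lTensor_tmul, LinearMap.rTensor_tmul, LinearMap.comp_apply]
        induction D x with
        | zero => simp
        | add t t' h h' => simp only [map_add, add_tmul, h, h']
        | tmul x y => simp
    rw [hD.mul_d_ι, map_add, map_add, map_add, hD.rTensor_mul_map_ι, hDH.lTensor_mul_map_d_ι,
      hD.rTensor_mul_map_d_ι, hDH.lTensor_mul_map_ι, map_add]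
    simp only [assoc_mul, assoc_map, S.assoc_rTensor, e1, e2, hx]
    abel

end Coassoc

section LeftCovariant

variable {k : Type*} [CommRing k] {H : Type*} [Ring H] [HopfAlgebra k H]
variable {ΩH : Type*} [Ring ΩH] [Algebra k ΩH] {CH : DiffCalc k H ΩH}
variable {ΛL : ΩH →ₗ[k] H ⊗[k] ΩH}

lemma rTensor_algHom_mul {X Y Z : Type*} [Ring X] [Algebra k X] [Ring Y] [Algebra k Y] [Ring Z]
    [Algebra k Z] (f : X →ₐ[k] Y) (s t : X ⊗[k] Z) :
    LinearMap.rTensor Z f.toLinearMap (s * t) =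
      LinearMap.rTensor Z f.toLinearMap s * LinearMap.rTensor Z f.toLinearMap t :=
  map_mul (Algebra.TensorProduct.map f (AlgHom.id k Z)) s t

lemma rTensor_lTensor_apply {P Q P' Q' : Type*} [AddCommGroup P] [Module k P] [AddCommGroup Q]
    [Module k Q] [AddCommGroup P'] [Module k P'] [AddCommGroup Q'] [Module k Q'] (f : P →ₗ[k] P')
    (g : Q →ₗ[k] Q') (t : P ⊗[k] Q) :
    LinearMap.rTensor Q' f (LinearMap.lTensor P g t) = TensorProduct.map f g t :=
  LinearMap.congr_fun (LinearMap.rTensor_comp_lTensor (f := f) (g := g)) t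

lemma comulComod_ρ_apply (h : H) : (comulComod k H).ρ h = Coalgebra.comul (R := k) h := rfl

section

variable (hΛ : IsLeftCovariantH CH ΛL)
include hΛ

lemma IsLeftCovariantH.map_ι (h : H) :
    ΛL (CH.ι h) = LinearMap.lTensor H CH.ι.toLinearMap (Coalgebra.comul (R := k) h) :=
  LinearMap.congr_fun hΛ.2.2.2.2.2 h

lemma IsLeftCovariantH.map_d_ι (h : H) :
    ΛL (CH.d (CH.ι h)) =
      LinearMap.lTensor H (CH.d ∘ₗ CH.ι.toLinearMap) (Coalgebra.comul (R := k) h) := by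
  have := LinearMap.congr_fun hΛ.2.2.2.2.1 (CH.ι h)
  rw [LinearMap.comp_apply, LinearMap.comp_apply, hΛ.map_ι] at this
  rw [this, LinearMap.lTensor_comp, LinearMap.comp_apply]

lemma IsLeftCovariantH.rTensor_mul_ι (x : ΩH) (h : H) :
    LinearMap.rTensor ΩH CH.ι.toLinearMap (ΛL (x * CH.ι h)) =
      LinearMap.rTensor ΩH CH.ι.toLinearMap (ΛL x) *
        TensorProduct.map CH.ι.toLinearMap CH.ι.toLinearMap (Coalgebra.comul (R := k) h) := by
  rw [hΛ.2.2.1, rTensor_algHom_mul, hΛ.map_ι, rTensor_lTensor_apply]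

lemma IsLeftCovariantH.rTensor_mul_d_ι (x : ΩH) (h : H) :
    LinearMap.rTensor ΩH CH.ι.toLinearMap (ΛL (x * CH.d (CH.ι h))) =
      LinearMap.rTensor ΩH CH.ι.toLinearMap (ΛL x) *
        TensorProduct.map CH.ι.toLinearMap (CH.d ∘ₗ CH.ι.toLinearMap)
          (Coalgebra.comul (R := k) h) := by
  rw [hΛ.2.2.1, rTensor_algHom_mul, hΛ.map_d_ι, rTensor_lTensor_apply]

lemma IsLeftCovariantH.lTensor_projN {n : ℕ} {x : ΩH} (hx : x ∈ CH.grading n) (j : ℕ) :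
    LinearMap.lTensor H (CH.projN j) (ΛL x) = ΛL (CH.projN j x) := by
  obtain ⟨u, hu⟩ := hΛ.2.2.2.1 n x hx
  have key : LinearMap.lTensor H (CH.projN j) (ΛL x) = if n = j then ΛL x else 0 := by
    rw [← hu, ← LinearMap.comp_apply, ← LinearMap.lTensor_comp]
    split_ifs with h
    · congr 2
      ext y
      simpa using DGA.projN_of_mem (h ▸ y.2)
    · have : CH.projN j ∘ₗ (CH.grading n).subtype = 0 := by
        ext y
        simpa using DGA.projN_of_mem_ne y.2 h
      simp [this]
  rw [key]
  split_ifs with h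
  · rw [DGA.projN_of_mem (h ▸ hx)]
  · rw [DGA.projN_of_mem_ne hx h, map_zero]

lemma IsLeftCovariantH.lTensor_projN_rTensor {n : ℕ} {x : ΩH} (hx : x ∈ CH.grading n) (j : ℕ) :
    LinearMap.lTensor ΩH (CH.projN j) (LinearMap.rTensor ΩH CH.ι.toLinearMap (ΛL x)) =
      LinearMap.rTensor ΩH CH.ι.toLinearMap (ΛL (CH.projN j x)) := by
  rw [← LinearMap.comp_apply, LinearMap.lTensor_comp_rTensor, ← LinearMap.rTensor_comp_lTensor,
    LinearMap.comp_apply, hΛ.lTensor_projN hx]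

lemma IsLeftCovariantH.rTensor_mem_degreeLT {n : ℕ} {x : ΩH} (hx : x ∈ CH.grading n) :
    LinearMap.rTensor ΩH CH.ι.toLinearMap (ΛL x) ∈ degreeLT CH.toDGA ΩH (n + 1) :=
  mem_degreeLT.2 fun j hj => by
    rw [hΛ.lTensor_projN_rTensor hx, DGA.projN_of_mem_ne hx (by omega), map_zero, map_zero]

lemma IsLeftCovariantH.sub_mem_degreeLT {DH : ΩH →ₗ[k] ΩH ⊗[k] ΩH} (hDH : IsCompleteExtH CH DH)
    {n : ℕ} {x : ΩH} (hx : x ∈ CH.grading n) :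
    DH x - LinearMap.rTensor ΩH CH.ι.toLinearMap (ΛL x) ∈ degreeLT CH.toDGA ΩH n := by
  refine (CH.graded_right_induction (fun n => (degreeLT CH.toDGA ΩH n).comap
    (DH - LinearMap.rTensor ΩH CH.ι.toLinearMap ∘ₗ ΛL) ⊓ CH.grading n) ?_ ?_ ?_ n hx).1
  · refine ⟨?_, CH.one_mem⟩
    simp [hDH.1, hΛ.2.1, Algebra.TensorProduct.one_def]
  · rintro n x ⟨hx, hxn⟩ a
    refine ⟨?_, DGA.mul_mem hxn (CH.ι_mem a)⟩
    change DH _ - LinearMap.rTensor ΩH CH.ι.toLinearMap (ΛL _) ∈ degreeLT _ _ _ at hx ⊢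
    rw [hDH.mul_ι, hΛ.rTensor_mul_ι, comulComod_ρ_apply, ← sub_mul]
    have := mul_map_mem_degreeLT (g := CH.ι.toLinearMap) CH.ι_mem CH.ι.toLinearMap hx
      (Coalgebra.comul (R := k) a)
    rwa [add_zero] at this
  · rintro n x ⟨hx, hxn⟩ a
    refine ⟨?_, DGA.mul_mem hxn (CH.d_ι_mem a)⟩
    change DH _ - LinearMap.rTensor ΩH CH.ι.toLinearMap (ΛL _) ∈ degreeLT _ _ _ at hx ⊢
    rw [hDH.mul_d_ι, hΛ.rTensor_mul_d_ι, comulComod_ρ_apply, add_sub_assoc,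
      ← sub_mul]
    have h1 : DH x ∈ degreeLT CH.toDGA ΩH (n + 1) := by
      rw [← sub_add_cancel (DH x)]
      exact add_mem (degreeLT_mono n.le_succ hx) (hΛ.rTensor_mem_degreeLT hxn)
    refine add_mem ?_ (mul_map_mem_degreeLT (g := CH.d ∘ₗ CH.ι.toLinearMap) CH.d_ι_mem _ hx _)
    have := mul_map_mem_degreeLT (g := CH.ι.toLinearMap) CH.ι_mem (CH.d ∘ₗ CH.ι.toLinearMap)
      (lTensor_sign_mem_degreeLT h1) (Coalgebra.comul (R := k) a)
    rwa [add_zero] at this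

lemma IsLeftCovariantH.lTensor_projN_of_le {DH : ΩH →ₗ[k] ΩH ⊗[k] ΩH}
    (hDH : IsCompleteExtH CH DH) {j n : ℕ} (hj : j ≤ n) {x : ΩH} (hx : x ∈ CH.grading j) :
    LinearMap.lTensor ΩH (CH.projN n) (DH x) =
      LinearMap.rTensor ΩH CH.ι.toLinearMap (ΛL (CH.projN n x)) := by
  have := mem_degreeLT.1 (hΛ.sub_mem_degreeLT hDH hx) n hj
  rwa [map_sub, hΛ.lTensor_projN_rTensor hx, sub_eq_zero] at this

end

variable {A : Type*} [Ring A] [Algebra k A] {S : ComodAlg k H A}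
variable {ΩA : Type*} [Ring ΩA] [Algebra k ΩA] {CA : DiffCalc k A ΩA}
variable {D : ΩA →ₗ[k] ΩA ⊗[k] ΩH}

lemma IsCompleteExt.assoc_top (hD : IsCompleteExt S CA CH D) {DH : ΩH →ₗ[k] ΩH ⊗[k] ΩH}
    (hDH : IsCompleteExtH CH DH) (hΛ : IsLeftCovariantH CH ΛL) {n : ℕ} {x : ΩA}
    (hx : D x ∈ degreeLT CH.toDGA ΩA (n + 1)) :
    TensorProduct.assoc k ΩA ΩH ΩH
        (LinearMap.rTensor ΩH D (LinearMap.lTensor ΩA (CH.projN n) (D x))) =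
      LinearMap.lTensor ΩA (LinearMap.rTensor ΩH CH.ι.toLinearMap ∘ₗ ΛL)
        (LinearMap.lTensor ΩA (CH.projN n) (D x)) := by
  have h1 : degreeLT CH.toDGA ΩA (n + 1) ≤ LinearMap.ker
      (LinearMap.lTensor ΩA (LinearMap.lTensor ΩH (CH.projN n) ∘ₗ DH) -
        LinearMap.lTensor ΩA (LinearMap.rTensor ΩH CH.ι.toLinearMap ∘ₗ ΛL ∘ₗ CH.projN n)) :=
    degreeLT_le fun j hj m y hy => by
      simp [hΛ.lTensor_projN_of_le hDH (Nat.lt_succ_iff.1 hj) hy]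
  have h2 := h1 hx
  rw [LinearMap.mem_ker, LinearMap.sub_apply, sub_eq_zero, LinearMap.lTensor_comp,
    LinearMap.comp_apply, ← hD.coassoc hDH] at h2
  rw [← LinearMap.comp_apply (LinearMap.lTensor ΩA _) (LinearMap.lTensor ΩA _),
    ← LinearMap.lTensor_comp, LinearMap.comp_assoc, ← h2]
  generalize D x = t
  induction t with
  | zero => simp
  | add t t' h h' => simp only [map_add, h, h']
  | tmul x y =>
    simp only [LinearMap.lTensor_tmul, LinearMap.rTensor_tmul]
    induction D x with
    | zero => simp
    | add t t' h h' => simp only [map_add, add_tmul, h, h']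
    | tmul x y => simp

end LeftCovariant

section StrongConnection

variable {k : Type*} [CommRing k] {H : Type*} [Ring H] [HopfAlgebra k H]
variable {A : Type*} [Ring A] [Algebra k A] {S : ComodAlg k H A} {ℓ : H →ₗ[k] A ⊗[k] A}
variable {ΩH : Type*} [Ring ΩH] [Algebra k ΩH] {CH : DiffCalc k H ΩH}
variable {ΩA : Type*} [Ring ΩA] [Algebra k ΩA] {CA : DiffCalc k A ΩA}
variable {ΛL : ΩH →ₗ[k] H ⊗[k] ΩH} {D : ΩA →ₗ[k] ΩA ⊗[k] ΩH}

lemma IsStrongConnection.mul_apply (hℓ : IsStrongConnection S ℓ) (h : H) :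
    LinearMap.mul' k A (ℓ h) = Coalgebra.counit (R := k) h • (1 : A) := by
  rw [← Algebra.algebraMap_eq_smul_one]
  exact LinearMap.congr_fun hℓ.2.2.1 h

lemma IsStrongConnection.rTensor_comp_mul (hℓ : IsStrongConnection S ℓ) (h h' : H) :
    TensorProduct.map (LinearMap.mul' k A) LinearMap.id
        (TensorProduct.tensorTensorTensorComm k A H A H
          (TensorProduct.assoc k (A ⊗[k] H) A H
            (LinearMap.rTensor A S.ρ.toLinearMap (ℓ h) ⊗ₜ h'))) =
      1 ⊗ₜ[k] (HopfAlgebra.antipode k h ⊗ₜ[k] h') := by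
  have h5 := LinearMap.congr_fun hℓ.2.2.2.2 h
  simp only [LinearMap.comp_apply, LinearEquiv.coe_coe] at h5
  have key : ∀ u : H ⊗[k] H, TensorProduct.map (LinearMap.mul' k A) LinearMap.id
        (TensorProduct.tensorTensorTensorComm k A H A H
          (TensorProduct.assoc k (A ⊗[k] H) A H
            (LinearMap.rTensor A (TensorProduct.comm k H A).toLinearMap
              ((TensorProduct.assoc k H A A).symm
                (TensorProduct.map (HopfAlgebra.antipode k) ℓ u)) ⊗ₜ h'))) =
      1 ⊗ₜ[k] (HopfAlgebra.antipode k
        (TensorProduct.rid k H (LinearMap.lTensor H Coalgebra.counit u)) ⊗ₜ[k] h') := by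
    intro u
    induction u with
    | zero => simp
    | add u u' h h' => simp only [map_add, add_tmul, tmul_add, h, h']
    | tmul p q =>
      have : ∀ v : A ⊗[k] A, TensorProduct.map (LinearMap.mul' k A) LinearMap.id
          (TensorProduct.tensorTensorTensorComm k A H A H
            (TensorProduct.assoc k (A ⊗[k] H) A H
              (LinearMap.rTensor A (TensorProduct.comm k H A).toLinearMap
                ((TensorProduct.assoc k H A A).symm (HopfAlgebra.antipode k p ⊗ₜ v)) ⊗ₜ h'))) =
          LinearMap.mul' k A v ⊗ₜ[k] (HopfAlgebra.antipode k p ⊗ₜ[k] h') := by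
        intro v
        induction v with
        | zero => simp
        | add u u' h h' => simp only [map_add, add_tmul, tmul_add, h, h']
        | tmul a b => simp
      rw [TensorProduct.map_tmul, this, hℓ.mul_apply]
      rw [smul_tmul, smul_tmul', LinearMap.lTensor_tmul, TensorProduct.rid_tmul, map_smul]
  rw [h5, key, Coalgebra.lTensor_counit_comul]
  simp

lemma IsStrongConnection.map_ρ_ρ (hℓ : IsStrongConnection S ℓ) (h : H) :
    TensorProduct.map (LinearMap.mul' k A) LinearMap.id
        (TensorProduct.tensorTensorTensorComm k A H A H
          (TensorProduct.map S.ρ.toLinearMap S.ρ.toLinearMap (ℓ h))) =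
      1 ⊗ₜ[k] (TensorProduct.map (HopfAlgebra.antipode k) LinearMap.id
        (Coalgebra.comul (R := k) h)) := by
  have h4 := LinearMap.congr_fun hℓ.2.2.2.1 h
  simp only [LinearMap.comp_apply, LinearEquiv.coe_coe] at h4
  rw [← rTensor_lTensor_apply (f := S.ρ.toLinearMap) (g := S.ρ.toLinearMap), h4]
  induction Coalgebra.comul (R := k) h with
  | zero => simp
  | add u u' h h' => simp only [map_add, tmul_add, h, h']
  | tmul p q =>
    rw [TensorProduct.map_tmul, LinearMap.id_apply, ← hℓ.rTensor_comp_mul]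
    congr 2
    rw [LinearMap.rTensor_tmul]
    induction ℓ p with
    | zero => simp
    | add u u' h h' => simp only [map_add, add_tmul, h, h']
    | tmul a b => simp

variable (S CH CA) in
/-- `a ⊗ a' ↦ ρ(a) t ρ(a')`, with `p` and `f` applied to the legs of `ρ(a')`. -/
def coactConj (p : A →ₗ[k] ΩA) (f : H →ₗ[k] ΩH) (t : ΩA ⊗[k] ΩH) :
    A ⊗[k] A →ₗ[k] ΩA ⊗[k] ΩH :=
  LinearMap.mul' k (ΩA ⊗[k] ΩH) ∘ₗ
    TensorProduct.map
      (LinearMap.mulRight k t ∘ₗ TensorProduct.map CA.ι.toLinearMap CH.ι.toLinearMap ∘ₗ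
        S.ρ.toLinearMap)
      (TensorProduct.map p f ∘ₗ S.ρ.toLinearMap)

lemma coactConj_tmul (p : A →ₗ[k] ΩA) (f : H →ₗ[k] ΩH) (t : ΩA ⊗[k] ΩH) (a a' : A) :
    coactConj S CH CA p f t (a ⊗ₜ a') =
      TensorProduct.map CA.ι.toLinearMap CH.ι.toLinearMap (S.ρ a) * t *
        TensorProduct.map p f (S.ρ a') := rfl

lemma coactConj_add (p : A →ₗ[k] ΩA) (f : H →ₗ[k] ΩH) (t t' : ΩA ⊗[k] ΩH) (w : A ⊗[k] A) :
    coactConj S CH CA p f (t + t') w = coactConj S CH CA p f t w + coactConj S CH CA p f t' w := by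
  induction w with
  | zero => simp
  | add w w' h h' => simp only [map_add, h, h']; abel
  | tmul a a' => simp only [coactConj_tmul, mul_add, add_mul]

lemma coactConj_mem_degreeLT {f : H →ₗ[k] ΩH} {i : ℕ} (hf : ∀ h, f h ∈ CH.grading i)
    (p : A →ₗ[k] ΩA) {n : ℕ} {t : ΩA ⊗[k] ΩH} (ht : t ∈ degreeLT CH.toDGA ΩA n) (w : A ⊗[k] A) :
    coactConj S CH CA p f t w ∈ degreeLT CH.toDGA ΩA (n + i) := by
  induction w with
  | zero => simp
  | add w w' h h' => rw [map_add]; exact add_mem h h'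
  | tmul a a' =>
    rw [coactConj_tmul]
    refine mul_map_mem_degreeLT hf p ?_ _
    induction S.ρ a with
    | zero => simp
    | add u u' h h' => rw [map_add, add_mul]; exact add_mem h h'
    | tmul x y => exact tmul_mul_mem_degreeLT (CH.ι_mem y) _ ht

lemma IsStrongConnection.coactConj_apply (hℓ : IsStrongConnection S ℓ) (f : H →ₗ[k] ΩH) (y : ΩH)
    (h : H) :
    coactConj S CH CA CA.ι.toLinearMap f (1 ⊗ₜ y) (ℓ h) =
      1 ⊗ₜ[k] LinearMap.mul' k ΩH
        (TensorProduct.map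
          (LinearMap.mulRight k y ∘ₗ CH.ι.toLinearMap ∘ₗ HopfAlgebra.antipode k) f
          (Coalgebra.comul (R := k) h)) := by
  have key : ∀ w : A ⊗[k] A, coactConj S CH CA CA.ι.toLinearMap f (1 ⊗ₜ y) w =
      TensorProduct.map CA.ι.toLinearMap
        (LinearMap.mul' k ΩH ∘ₗ
          TensorProduct.map (LinearMap.mulRight k y ∘ₗ CH.ι.toLinearMap) f)
        (TensorProduct.map (LinearMap.mul' k A) LinearMap.id
          (TensorProduct.tensorTensorTensorComm k A H A H
            (TensorProduct.map S.ρ.toLinearMap S.ρ.toLinearMap w))) := by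
    intro w
    induction w with
    | zero => simp
    | add w w' h h' => simp only [map_add, h, h']
    | tmul a a' =>
      rw [coactConj_tmul, TensorProduct.map_tmul]
      change _ = TensorProduct.map _ _ (TensorProduct.map _ _
        (TensorProduct.tensorTensorTensorComm k A H A H (S.ρ a ⊗ₜ S.ρ a')))
      induction S.ρ a with
      | zero => simp
      | add u u' h h' => simp only [map_add, add_mul, add_tmul, h, h']
      | tmul c g =>
        induction S.ρ a' with
        | zero => simp
        | add u u' h h' => simp only [map_add, mul_add, tmul_add, h, h']
        | tmul c' g' => simp
  rw [key, hℓ.map_ρ_ρ, TensorProduct.map_tmul, AlgHom.toLinearMap_apply, map_one]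
  congr 1
  rw [LinearMap.comp_apply, ← LinearMap.comp_apply (TensorProduct.map _ _),
    ← TensorProduct.map_comp]
  rfl

lemma IsLeftCovariantH.piLam_mul (hΛ : IsLeftCovariantH CH ΛL) (f : H →ₗ[k] ΩH) {x z : ΩH} {h : H}
    (hz : ΛL z = LinearMap.lTensor H f (Coalgebra.comul (R := k) h)) :
    piLam CH ΛL (x * z) = LinearMap.mul' k ΩH
      (TensorProduct.map
        (LinearMap.mulRight k (piLam CH ΛL x) ∘ₗ CH.ι.toLinearMap ∘ₗ HopfAlgebra.antipode k) f
        (Coalgebra.comul (R := k) h)) := by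
  simp only [piLam, LinearMap.comp_apply, hΛ.2.2.1, hz]
  generalize ΛL x = t
  induction t with
  | zero => simp
  | add t t' h h' =>
    rw [add_mul, map_add, map_add, h, h']
    induction Coalgebra.comul (R := k) ‹H› with
    | zero => simp
    | add u u' h h' => simp only [map_add] at h h' ⊢; rw [← h, ← h']; abel
    | tmul a b => simp [mul_add, add_mul]
  | tmul p q =>
    induction Coalgebra.comul (R := k) h with
    | zero => simp
    | add u u' h h' => simp only [map_add, mul_add, h, h']
    | tmul a b => simp [HopfAlgebra.antipode_mul_antidistrib, mul_assoc]

lemma IsLeftCovariantH.piLam_mem (hΛ : IsLeftCovariantH CH ΛL) {n : ℕ} {x : ΩH}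
    (hx : x ∈ CH.grading n) : piLam CH ΛL x ∈ CH.grading n := by
  obtain ⟨u, hu⟩ := hΛ.2.2.2.1 n x hx
  simp only [piLam, LinearMap.comp_apply, ← hu]
  clear hu
  induction u with
  | zero => simp
  | add u u' h h' => simp only [map_add]; exact add_mem h h'
  | tmul p q => simpa using DGA.mul_mem (CH.ι_mem (HopfAlgebra.antipode k p)) q.2

lemma IsCompleteExt.coactConj_ι_mem_range (hD : IsCompleteExt S CA CH D) (b : ΩA) (w : A ⊗[k] A) :
    coactConj S CH CA CA.ι.toLinearMap CH.ι.toLinearMap (D b) w ∈ LinearMap.range D := by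
  induction w with
  | zero => simp
  | add w w' h h' => rw [map_add]; exact add_mem h h'
  | tmul a a' => exact ⟨CA.ι a * b * CA.ι a', by rw [hD.mul_ι, hD.ι_mul, coactConj_tmul]⟩

lemma IsCompleteExt.coactConj_d_ι_mem_range (hD : IsCompleteExt S CA CH D) (b : ΩA)
    (w : A ⊗[k] A) :
    coactConj S CH CA (CA.d ∘ₗ CA.ι.toLinearMap) CH.ι.toLinearMap
          (LinearMap.lTensor ΩA CH.sign (D b)) w +
        coactConj S CH CA CA.ι.toLinearMap (CH.d ∘ₗ CH.ι.toLinearMap) (D b) w ∈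
      LinearMap.range D := by
  induction w with
  | zero => simp
  | add w w' h h' => rw [map_add, map_add, add_add_add_comm]; exact add_mem h h'
  | tmul a a' =>
    refine ⟨CA.ι a * (b * CA.d (CA.ι a')), ?_⟩
    rw [hD.ι_mul, hD.mul_d_ι, coactConj_tmul, coactConj_tmul, mul_add, mul_assoc, mul_assoc]

lemma IsCompleteExt.one_tmul_piLam_mem (hD : IsCompleteExt S CA CH D)
    (hΛ : IsLeftCovariantH CH ΛL) (hℓ : IsStrongConnection S ℓ) {n : ℕ} {θ : ΩH}
    (hθ : θ ∈ CH.grading n) :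
    1 ⊗ₜ piLam CH ΛL θ ∈ LinearMap.range D ⊔ degreeLT CH.toDGA ΩA n := by
  refine (CH.graded_right_induction (fun n => (LinearMap.range D ⊔ degreeLT CH.toDGA ΩA n).comap
    (TensorProduct.mk k ΩA ΩH 1 ∘ₗ piLam CH ΛL) ⊓ CH.grading n) ?_ ?_ ?_ n hθ).1
  · refine ⟨Submodule.mem_sup_left ⟨1, ?_⟩, CH.one_mem⟩
    simp [hD.1, piLam, hΛ.2.1, Algebra.TensorProduct.one_def]
  · rintro n x ⟨hx, hxn⟩ h
    refine ⟨?_, DGA.mul_mem hxn (CH.ι_mem h)⟩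
    obtain ⟨_, ⟨b, rfl⟩, r, hr, hbr⟩ := Submodule.mem_sup.1 
      (show 1 ⊗ₜ piLam CH ΛL x ∈ LinearMap.range D ⊔ degreeLT CH.toDGA ΩA n from hx)
    change 1 ⊗ₜ[k] piLam CH ΛL (x * CH.ι h) ∈ LinearMap.range D ⊔ degreeLT CH.toDGA ΩA n
    rw [hΛ.piLam_mul CH.ι.toLinearMap (hΛ.map_ι h), ← hℓ.coactConj_apply (CA := CA), ← hbr,
      coactConj_add]
    have := coactConj_mem_degreeLT (S := S) (CA := CA) (f := CH.ι.toLinearMap) CH.ι_mem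
      CA.ι.toLinearMap hr (ℓ h)
    exact add_mem (Submodule.mem_sup_left (hD.coactConj_ι_mem_range b _))
      (Submodule.mem_sup_right this)
  · rintro n x ⟨hx, hxn⟩ h
    refine ⟨?_, DGA.mul_mem hxn (CH.d_ι_mem h)⟩
    obtain ⟨_, ⟨b, rfl⟩, r, hr, hbr⟩ := Submodule.mem_sup.1 
      (show 1 ⊗ₜ piLam CH ΛL x ∈ LinearMap.range D ⊔ degreeLT CH.toDGA ΩA n from hx)
    change 1 ⊗ₜ[k] piLam CH ΛL (x * CH.d (CH.ι h)) ∈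
      LinearMap.range D ⊔ degreeLT CH.toDGA ΩA (n + 1)
    have hb : D b ∈ degreeLT CH.toDGA ΩA (n + 1) := by
      rw [eq_sub_of_add_eq hbr]
      refine sub_mem (mem_degreeLT.2 fun j hj => ?_) (degreeLT_mono n.le_succ hr)
      rw [LinearMap.lTensor_tmul, DGA.projN_of_mem_ne (hΛ.piLam_mem hxn) (by omega), tmul_zero]
    rw [hΛ.piLam_mul (CH.d ∘ₗ CH.ι.toLinearMap) (hΛ.map_d_ι h), ← hℓ.coactConj_apply (CA := CA),
      ← hbr, coactConj_add]
    refine add_mem ?_ (Submodule.mem_sup_right (coactConj_mem_degreeLT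
      (f := CH.d ∘ₗ CH.ι.toLinearMap) CH.d_ι_mem CA.ι.toLinearMap hr (ℓ h)))
    rw [← add_sub_cancel_left (coactConj S CH CA (CA.d ∘ₗ CA.ι.toLinearMap) CH.ι.toLinearMap
      (LinearMap.lTensor ΩA CH.sign (D b)) (ℓ h)) (coactConj S CH CA CA.ι.toLinearMap _ (D b) _)]
    refine sub_mem (Submodule.mem_sup_left (hD.coactConj_d_ι_mem_range b _))
      (Submodule.mem_sup_right ?_)
    exact coactConj_mem_degreeLT (f := CH.ι.toLinearMap) CH.ι_mem _
      (lTensor_sign_mem_degreeLT hb) (ℓ h)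

end StrongConnection

section

lemma exists_linearMap_sub_mem {k U V W : Type*} [Field k] [AddCommGroup U] [Module k U]
    [AddCommGroup V] [Module k V] [AddCommGroup W] [Module k W] (f : V →ₗ[k] W) (g : U →ₗ[k] W)
    (F : Submodule k W) (h : ∀ v, f v ∈ LinearMap.range g ⊔ F) :
    ∃ β : V →ₗ[k] U, ∀ v, g (β v) - f v ∈ F := by
  have hf : ∀ v, F.mkQ (f v) ∈ LinearMap.range (F.mkQ ∘ₗ g) := fun v => by
    obtain ⟨_, ⟨u, rfl⟩, r, hr, huv⟩ := Submodule.mem_sup.1 (h v)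
    refine ⟨u, ?_⟩
    rw [← huv, map_add, show F.mkQ r = 0 from (Submodule.Quotient.mk_eq_zero F).2 hr, add_zero,
      LinearMap.comp_apply]
  obtain ⟨β, hβ⟩ := Module.projective_lifting_property (F.mkQ ∘ₗ g).rangeRestrict
    ((F.mkQ ∘ₗ f).codRestrict _ hf) (LinearMap.surjective_rangeRestrict _)
  refine ⟨β, fun v => ?_⟩
  have := congrArg Subtype.val (LinearMap.congr_fun hβ v)
  rw [← Submodule.Quotient.mk_eq_zero, Submodule.Quotient.mk_sub, sub_eq_zero]
  exact this

lemma DGA.exists_linearMap_of_forall_mem {k Ξ U W : Type*} [Field k] [Ring Ξ] [Algebra k Ξ]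
    [AddCommGroup U] [Module k U] [AddCommGroup W] [Module k W] (C : DGA k Ξ)
    (f : Ξ →ₗ[k] W) (g : U →ₗ[k] W) (F : ℕ → Submodule k W)
    (h : ∀ n, ∀ x ∈ C.grading n, f x ∈ LinearMap.range g ⊔ F n) :
    ∃ β : Ξ →ₗ[k] U, ∀ n, ∀ x ∈ C.grading n, g (β x) - f x ∈ F n := by
  let := C.gradedAlgebra
  choose β hβ using fun n => exists_linearMap_sub_mem (f ∘ₗ (C.grading n).subtype) g (F n)
    fun v => h n v v.2
  refine ⟨DirectSum.toModule k ℕ U β ∘ₗ (DirectSum.decomposeLinearEquiv C.grading).toLinearMap,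
    fun n x hx => ?_⟩
  lift x to C.grading n using hx
  simpa [DirectSum.toModule_lof] using hβ n x

section Filtration

variable {k : Type*} [CommRing k] {Ξ : Type*} [Ring Ξ] [Algebra k Ξ] {C : DGA k Ξ}
variable {M : Type*} [AddCommGroup M] [Module k M]

lemma bijective_of_sub_mem_degreeLT (Ψ : M ⊗[k] Ξ →ₗ[k] M ⊗[k] Ξ)
    (hΨ : ∀ n, ∀ s ∈ degreeLT C M (n + 1), Ψ s - s ∈ degreeLT C M n) : Function.Bijective Ψ := by
  constructor
  · refine (injective_iff_map_eq_zero Ψ).2 fun s hs => ?_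
    obtain ⟨n, hn⟩ := exists_mem_degreeLT (C := C) s
    induction n with
    | zero => exact eq_zero_of_mem_degreeLT_zero hn
    | succ n ih =>
      have := hΨ n s hn
      rw [hs, zero_sub, neg_mem_iff] at this
      exact ih this
  · have key : ∀ n, degreeLT C M n ≤ LinearMap.range Ψ := by
      intro n
      induction n with
      | zero => exact fun s hs => eq_zero_of_mem_degreeLT_zero hs ▸ zero_mem _
      | succ n ih =>
        intro s hs
        rw [← sub_sub_cancel (Ψ s) s]
        exact sub_mem ⟨s, rfl⟩ (ih (hΨ n s hs))
    intro s
    obtain ⟨n, hn⟩ := exists_mem_degreeLT (C := C) s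
    exact key n hn

end Filtration

section Translation

variable {k : Type*} [CommRing k] {H : Type*} [Ring H] [HopfAlgebra k H]
variable {A : Type*} [Ring A] [Algebra k A] {S : ComodAlg k H A} {ℓ : H →ₗ[k] A ⊗[k] A}
variable {ΩH : Type*} [Ring ΩH] [Algebra k ΩH] {CH : DiffCalc k H ΩH}
variable {ΩA : Type*} [Ring ΩA] [Algebra k ΩA] {CA : DiffCalc k A ΩA}
variable {ΛL : ΩH →ₗ[k] H ⊗[k] ΩH} {D : ΩA →ₗ[k] ΩA ⊗[k] ΩH}

lemma chiAux_tmul (a a' : A) : chiAux S (a ⊗ₜ a') = (a ⊗ₜ 1) * S.ρ a' := rfl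

lemma chiBulAux_tmul (D : ΩA →ₗ[k] ΩA ⊗[k] ΩH) (x y : ΩA) :
    chiBulAux D (x ⊗ₜ y) = (x ⊗ₜ 1) * D y := by
  simp only [chiBulAux, LinearMap.comp_apply, LinearMap.lTensor_tmul]
  induction D y with
  | zero => simp
  | add t t' h h' => simp only [tmul_add, map_add, mul_add, h, h']
  | tmul a b => simp

lemma chiBulAux_tmul_one_mul (D : ΩA →ₗ[k] ΩA ⊗[k] ΩH) (x : ΩA) (z : ΩA ⊗[k] ΩA) :
    chiBulAux D ((x ⊗ₜ 1) * z) = (x ⊗ₜ 1) * chiBulAux D z := by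
  induction z with
  | zero => simp
  | add t t' h h' => simp only [map_add, mul_add, h, h']
  | tmul a b => simp [chiBulAux_tmul, ← mul_assoc]

lemma map_ι_ι_mul (CA : DiffCalc k A ΩA) (CH : DiffCalc k H ΩH) (s t : A ⊗[k] H) :
    TensorProduct.map CA.ι.toLinearMap CH.ι.toLinearMap (s * t) =
      TensorProduct.map CA.ι.toLinearMap CH.ι.toLinearMap s *
        TensorProduct.map CA.ι.toLinearMap CH.ι.toLinearMap t :=
  map_mul (Algebra.TensorProduct.map CA.ι CH.ι) s t

lemma IsCompleteExt.chiBulAux_map_ι_mul (hD : IsCompleteExt S CA CH D) (w : A ⊗[k] A) (y : ΩA) :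
    chiBulAux D (TensorProduct.map CA.ι.toLinearMap CA.ι.toLinearMap w * (1 ⊗ₜ y)) =
      TensorProduct.map CA.ι.toLinearMap CH.ι.toLinearMap (chiAux S w) * D y := by
  induction w with
  | zero => simp
  | add w w' h h' => simp only [map_add, add_mul, h, h']
  | tmul a a' =>
    rw [chiAux_tmul, map_ι_ι_mul, TensorProduct.map_tmul, TensorProduct.map_tmul,
      Algebra.TensorProduct.tmul_mul_tmul, mul_one, chiBulAux_tmul, AlgHom.toLinearMap_apply,
      AlgHom.toLinearMap_apply, hD.ι_mul, mul_assoc, AlgHom.toLinearMap_apply, map_one]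

lemma IsLeftCovariantH.counit (hΛ : IsLeftCovariantH CH ΛL) (θ : ΩH) :
    LinearMap.rTensor ΩH Coalgebra.counit (ΛL θ) = 1 ⊗ₜ[k] θ :=
  LinearMap.congr_fun hΛ.1.1 θ

lemma IsLeftCovariantH.coassoc (hΛ : IsLeftCovariantH CH ΛL) (θ : ΩH) :
    LinearMap.lTensor H ΛL (ΛL θ) =
      TensorProduct.assoc k H H ΩH (LinearMap.rTensor ΩH Coalgebra.comul (ΛL θ)) :=
  (LinearEquiv.symm_apply_eq _).1 (LinearMap.congr_fun hΛ.1.2 θ)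

lemma IsLeftCovariantH.mul_piLam (hΛ : IsLeftCovariantH CH ΛL) (θ : ΩH) :
    LinearMap.mul' k ΩH (TensorProduct.map CH.ι.toLinearMap (piLam CH ΛL) (ΛL θ)) = θ := by
  have h1 : TensorProduct.map CH.ι.toLinearMap (piLam CH ΛL) (ΛL θ) =
      TensorProduct.map CH.ι.toLinearMap (LinearMap.mul' k ΩH ∘ₗ
        TensorProduct.map (CH.ι.toLinearMap ∘ₗ HopfAlgebra.antipode k) LinearMap.id)
        (LinearMap.lTensor H ΛL (ΛL θ)) := by
    rw [← LinearMap.comp_apply _ (LinearMap.lTensor H ΛL), LinearMap.map_comp_lTensor]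
    rfl
  have h2 : ∀ u : H ⊗[k] ΩH, LinearMap.mul' k ΩH
      (TensorProduct.map CH.ι.toLinearMap (LinearMap.mul' k ΩH ∘ₗ
        TensorProduct.map (CH.ι.toLinearMap ∘ₗ HopfAlgebra.antipode k) LinearMap.id)
        (TensorProduct.assoc k H H ΩH (LinearMap.rTensor ΩH Coalgebra.comul u))) =
      TensorProduct.lid k ΩH (LinearMap.rTensor ΩH Coalgebra.counit u) := by
    intro u
    induction u with
    | zero => simp
    | add u u' h h' => simp only [map_add, h, h']
    | tmul h y =>
      have h3 : ∀ v : H ⊗[k] H, LinearMap.mul' k ΩH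
          (TensorProduct.map CH.ι.toLinearMap (LinearMap.mul' k ΩH ∘ₗ
            TensorProduct.map (CH.ι.toLinearMap ∘ₗ HopfAlgebra.antipode k) LinearMap.id)
            (TensorProduct.assoc k H H ΩH (v ⊗ₜ y))) =
          CH.ι (LinearMap.mul' k H (LinearMap.lTensor H (HopfAlgebra.antipode k) v)) * y := by
        intro v
        induction v with
        | zero => simp
        | add u u' h h' => simp only [map_add, add_tmul, add_mul, h, h']
        | tmul p q => simp [mul_assoc]
      rw [LinearMap.rTensor_tmul, h3, HopfAlgebra.mul_antipode_lTensor_comul_apply]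
      simp [Algebra.smul_def]
  rw [h1, hΛ.coassoc, h2, hΛ.counit]
  simp

variable (CA ΛL ℓ) in
/-- `h ⊗ θ ↦ ℓ(h) (1 ⊗ β(θ))`. -/
def translationAux (β : ΩH →ₗ[k] ΩA) : H ⊗[k] ΩH →ₗ[k] ΩA ⊗[k] ΩA :=
  LinearMap.mul' k (ΩA ⊗[k] ΩA) ∘ₗ
    TensorProduct.map (TensorProduct.map CA.ι.toLinearMap CA.ι.toLinearMap ∘ₗ ℓ)
      (TensorProduct.mk k ΩA ΩA 1 ∘ₗ β)

lemma translationAux_tmul (β : ΩH →ₗ[k] ΩA) (h : H) (y : ΩH) :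
    translationAux ℓ CA β (h ⊗ₜ y) =
      TensorProduct.map CA.ι.toLinearMap CA.ι.toLinearMap (ℓ h) * (1 ⊗ₜ β y) := rfl

variable (CA ΛL ℓ) in
/-- `ω ⊗ θ ↦ ω ℓ(θ₍₋₁₎) (1 ⊗ β(θ₍₀₎))`. -/
def translationLift (β : ΩH →ₗ[k] ΩA) : ΩA ⊗[k] ΩH →ₗ[k] ΩA ⊗[k] ΩA :=
  LinearMap.mul' k (ΩA ⊗[k] ΩA) ∘ₗ
    TensorProduct.map ((TensorProduct.mk k ΩA ΩA).flip 1) (translationAux ℓ CA β ∘ₗ ΛL)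

lemma translationLift_tmul (β : ΩH →ₗ[k] ΩA) (ω : ΩA) (θ : ΩH) :
    translationLift ℓ CA ΛL β (ω ⊗ₜ θ) = (ω ⊗ₜ 1) * translationAux ℓ CA β (ΛL θ) := rfl

lemma IsCompleteExt.chiBulAux_translationAux (hD : IsCompleteExt S CA CH D)
    (hℓ : IsStrongConnection S ℓ) (β : ΩH →ₗ[k] ΩA) (h : H) (y : ΩH) :
    chiBulAux D (translationAux ℓ CA β (h ⊗ₜ y)) = (1 ⊗ₜ CH.ι h) * D (β y) := by
  rw [translationAux_tmul, hD.chiBulAux_map_ι_mul,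
    show chiAux S (ℓ h) = 1 ⊗ₜ h from LinearMap.congr_fun hℓ.2.1 h]
  simp

lemma IsCompleteExt.chiBulAux_translationAux_sub_mem (hD : IsCompleteExt S CA CH D)
    (hΛ : IsLeftCovariantH CH ΛL) (hℓ : IsStrongConnection S ℓ) {β : ΩH →ₗ[k] ΩA}
    {n : ℕ} (hβ : ∀ x ∈ CH.grading n, D (β x) - 1 ⊗ₜ piLam CH ΛL x ∈ degreeLT CH.toDGA ΩA n)
    {θ : ΩH} (hθ : θ ∈ CH.grading n) :
    chiBulAux D (translationAux ℓ CA β (ΛL θ)) - 1 ⊗ₜ θ ∈ degreeLT CH.toDGA ΩA n := by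
  have key : ∀ u : H ⊗[k] CH.grading n,
      chiBulAux D (translationAux ℓ CA β (LinearMap.lTensor H (CH.grading n).subtype u)) -
        1 ⊗ₜ LinearMap.mul' k ΩH (TensorProduct.map CH.ι.toLinearMap (piLam CH ΛL)
          (LinearMap.lTensor H (CH.grading n).subtype u)) ∈ degreeLT CH.toDGA ΩA n := by
    intro u
    induction u with
    | zero => simp
    | add u u' h h' =>
      simp only [map_add, tmul_add]
      rw [add_sub_add_comm]
      exact add_mem h h'
    | tmul h y =>
      have := tmul_mul_mem_degreeLT (CH.ι_mem h) 1 (hβ y y.2)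
      rw [mul_sub, Algebra.TensorProduct.tmul_mul_tmul, mul_one] at this
      rwa [LinearMap.lTensor_tmul, hD.chiBulAux_translationAux hℓ]
  obtain ⟨u, hu⟩ := hΛ.2.2.2.1 n θ hθ
  have := key u
  rwa [hu, hΛ.mul_piLam] at this

lemma IsCompleteExt.chiBulAux_translationLift_sub_mem (hD : IsCompleteExt S CA CH D)
    (hΛ : IsLeftCovariantH CH ΛL) (hℓ : IsStrongConnection S ℓ) {β : ΩH →ₗ[k] ΩA}
    (hβ : ∀ n, ∀ x ∈ CH.grading n, D (β x) - 1 ⊗ₜ piLam CH ΛL x ∈ degreeLT CH.toDGA ΩA n)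
    (n : ℕ) {s : ΩA ⊗[k] ΩH} (hs : s ∈ degreeLT CH.toDGA ΩA (n + 1)) :
    chiBulAux D (translationLift ℓ CA ΛL β s) - s ∈ degreeLT CH.toDGA ΩA n := by
  have key : degreeLT CH.toDGA ΩA (n + 1) ≤ (degreeLT CH.toDGA ΩA n).comap
      (chiBulAux D ∘ₗ translationLift ℓ CA ΛL β - LinearMap.id) := by
    refine degreeLT_le fun j hj ω θ hθ => ?_
    have := tmul_mul_mem_degreeLT CH.one_mem ω
      (hD.chiBulAux_translationAux_sub_mem hΛ hℓ (hβ j) hθ)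
    rw [mul_sub, Algebra.TensorProduct.tmul_mul_tmul, mul_one, one_mul] at this
    rw [Submodule.mem_comap, LinearMap.sub_apply, LinearMap.comp_apply, translationLift_tmul,
      chiBulAux_tmul_one_mul]
    exact degreeLT_mono (Nat.lt_succ_iff.1 hj) this
  exact key hs

end Translation

end

section Descent

variable {k : Type*} [CommRing k] {H : Type*} [Ring H] [HopfAlgebra k H]
variable {A : Type*} [Ring A] [Algebra k A] {S : ComodAlg k H A} {ℓ : H →ₗ[k] A ⊗[k] A}
variable {ΩH : Type*} [Ring ΩH] [Algebra k ΩH] {CH : DiffCalc k H ΩH}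
variable {ΩA : Type*} [Ring ΩA] [Algebra k ΩA] {CA : DiffCalc k A ΩA}
variable {ΛL : ΩH →ₗ[k] H ⊗[k] ΩH} {D : ΩA →ₗ[k] ΩA ⊗[k] ΩH}

lemma IsStrongConnection.mul_rTensor_ρ (hℓ : IsStrongConnection S ℓ) (h : H) :
    LinearMap.mul' k ((A ⊗[k] H) ⊗[k] A)
        (TensorProduct.map ((TensorProduct.mk k (A ⊗[k] H) A).flip 1 ∘ₗ TensorProduct.mk k A H 1)
          (LinearMap.rTensor A S.ρ.toLinearMap ∘ₗ ℓ) (Coalgebra.comul (R := k) h)) =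
      LinearMap.rTensor A ((TensorProduct.mk k A H).flip 1) (ℓ h) := by
  have key : ∀ (q : H) (v : H ⊗[k] H), LinearMap.mul' k ((A ⊗[k] H) ⊗[k] A)
      (TensorProduct.map ((TensorProduct.mk k (A ⊗[k] H) A).flip 1 ∘ₗ TensorProduct.mk k A H 1)
        (LinearMap.rTensor A (TensorProduct.comm k H A).toLinearMap ∘ₗ
          (TensorProduct.assoc k H A A).symm.toLinearMap ∘ₗ
          TensorProduct.map (HopfAlgebra.antipode k) ℓ)
        (TensorProduct.assoc k H H H (v ⊗ₜ q))) =
      ((1 ⊗ₜ LinearMap.mul' k H (LinearMap.lTensor H (HopfAlgebra.antipode k) v)) ⊗ₜ 1) *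
        LinearMap.rTensor A ((TensorProduct.mk k A H).flip 1) (ℓ q) := by
    intro q v
    induction v with
    | zero => simp
    | add v v' h h' => simp only [add_tmul, map_add, tmul_add, add_mul, h, h']
    | tmul x y =>
      simp only [TensorProduct.assoc_tmul, TensorProduct.map_tmul, LinearMap.comp_apply,
        LinearMap.lTensor_tmul, LinearMap.mul'_apply, LinearEquiv.coe_coe]
      induction ℓ q with
      | zero => simp
      | add w w' h h' => simp only [tmul_add, map_add, mul_add, h, h']
      | tmul a b => simp
  have h5 : LinearMap.rTensor A S.ρ.toLinearMap ∘ₗ ℓ =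
      (LinearMap.rTensor A (TensorProduct.comm k H A).toLinearMap ∘ₗ
        (TensorProduct.assoc k H A A).symm.toLinearMap ∘ₗ
        TensorProduct.map (HopfAlgebra.antipode k) ℓ) ∘ₗ Coalgebra.comul (R := k) :=
    hℓ.2.2.2.2
  rw [h5, ← LinearMap.map_comp_lTensor, LinearMap.comp_apply, ← Coalgebra.coassoc_apply]
  have key' : ∀ u : H ⊗[k] H, LinearMap.mul' k ((A ⊗[k] H) ⊗[k] A)
      (TensorProduct.map ((TensorProduct.mk k (A ⊗[k] H) A).flip 1 ∘ₗ TensorProduct.mk k A H 1)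
        (LinearMap.rTensor A (TensorProduct.comm k H A).toLinearMap ∘ₗ
          (TensorProduct.assoc k H A A).symm.toLinearMap ∘ₗ
          TensorProduct.map (HopfAlgebra.antipode k) ℓ)
        (TensorProduct.assoc k H H H (LinearMap.rTensor H Coalgebra.comul u))) =
      LinearMap.rTensor A ((TensorProduct.mk k A H).flip 1)
        (ℓ (TensorProduct.lid k H (LinearMap.rTensor H Coalgebra.counit u))) := by
    intro u
    induction u with
    | zero => simp
    | add v v' h h' => simp only [map_add, h, h']
    | tmul p q =>
      rw [LinearMap.rTensor_tmul, key, HopfAlgebra.mul_antipode_lTensor_comul_apply]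
      rw [Algebra.algebraMap_eq_smul_one, tmul_smul, ← smul_tmul', smul_mul_assoc]
      simp [← Algebra.TensorProduct.one_def]
  rw [key', Coalgebra.rTensor_counit_comul]
  simp

lemma rTensor_map_ι_ι (CA : DiffCalc k A ΩA) (CH : DiffCalc k H ΩH) (s t : (A ⊗[k] H) ⊗[k] A) :
    TensorProduct.map (TensorProduct.map CA.ι.toLinearMap CH.ι.toLinearMap) CA.ι.toLinearMap
        (s * t) =
      TensorProduct.map (TensorProduct.map CA.ι.toLinearMap CH.ι.toLinearMap) CA.ι.toLinearMap s *
      TensorProduct.map (TensorProduct.map CA.ι.toLinearMap CH.ι.toLinearMap) CA.ι.toLinearMap t :=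
  map_mul (Algebra.TensorProduct.map (Algebra.TensorProduct.map CA.ι CH.ι) CA.ι) s t

variable (S ℓ CH CA) in
/-- `h ⊗ θ ↦ (ρ ⊗ 1)(ℓ(h)) (1 ⊗ β(θ))`. -/
def coactTranslationAux (β : ΩH →ₗ[k] ΩA) : H ⊗[k] ΩH →ₗ[k] (ΩA ⊗[k] ΩH) ⊗[k] ΩA :=
  LinearMap.mul' k ((ΩA ⊗[k] ΩH) ⊗[k] ΩA) ∘ₗ
    TensorProduct.map
      (TensorProduct.map (TensorProduct.map CA.ι.toLinearMap CH.ι.toLinearMap) CA.ι.toLinearMap ∘ₗ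
        LinearMap.rTensor A S.ρ.toLinearMap ∘ₗ ℓ)
      (TensorProduct.mk k (ΩA ⊗[k] ΩH) ΩA 1 ∘ₗ β)

lemma IsCompleteExt.rTensor_translationAux (hD : IsCompleteExt S CA CH D) (β : ΩH →ₗ[k] ΩA)
    (a : ΩA) (u : H ⊗[k] ΩH) :
    LinearMap.rTensor ΩA D ((a ⊗ₜ 1) * translationAux ℓ CA β u) =
      (D a ⊗ₜ 1) * coactTranslationAux S ℓ CH CA β u := by
  induction u with
  | zero => simp
  | add u u' h h' => simp only [map_add, mul_add, h, h']
  | tmul h y =>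
    rw [translationAux_tmul]
    simp only [coactTranslationAux, LinearMap.comp_apply, TensorProduct.map_tmul,
      LinearMap.mul'_apply, TensorProduct.mk_apply]
    induction ℓ h with
    | zero => simp
    | add w w' h h' => simp only [map_add, add_mul, mul_add, h, h']
    | tmul p q => simp [hD.mul_ι]

variable (S ℓ CH CA) in
/-- `(s ⊗ θ) ↦ (s ⊗ 1) (ρ ⊗ 1)(ℓ(θ₍₋₁₎)) (1 ⊗ β(θ₍₀₎))`. -/
def coactTranslationLift (ΛL : ΩH →ₗ[k] H ⊗[k] ΩH) (β : ΩH →ₗ[k] ΩA) :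
    (ΩA ⊗[k] ΩH) ⊗[k] ΩH →ₗ[k] (ΩA ⊗[k] ΩH) ⊗[k] ΩA :=
  LinearMap.mul' k ((ΩA ⊗[k] ΩH) ⊗[k] ΩA) ∘ₗ
    TensorProduct.map ((TensorProduct.mk k (ΩA ⊗[k] ΩH) ΩA).flip 1)
      (coactTranslationAux S ℓ CH CA β ∘ₗ ΛL)

lemma IsCompleteExt.rTensor_translationLift (hD : IsCompleteExt S CA CH D) (β : ΩH →ₗ[k] ΩA)
    (t : ΩA ⊗[k] ΩH) :
    LinearMap.rTensor ΩA D (translationLift ℓ CA ΛL β t) =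
      coactTranslationLift S ℓ CH CA ΛL β (LinearMap.rTensor ΩH D t) := by
  induction t with
  | zero => simp
  | add u u' h h' => simp only [map_add, h, h']
  | tmul a θ => exact hD.rTensor_translationAux β a (ΛL θ)

lemma IsStrongConnection.coactTranslationLift_assoc_symm (hℓ : IsStrongConnection S ℓ)
    (hΛ : IsLeftCovariantH CH ΛL) (β : ΩH →ₗ[k] ΩA) (t : ΩA ⊗[k] ΩH) :
    coactTranslationLift S ℓ CH CA ΛL β ((TensorProduct.assoc k ΩA ΩH ΩH).symm
        (LinearMap.lTensor ΩA (LinearMap.rTensor ΩH CH.ι.toLinearMap ∘ₗ ΛL) t)) =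
      LinearMap.rTensor ΩA ((TensorProduct.mk k ΩA ΩH).flip 1) (translationLift ℓ CA ΛL β t) := by
  induction t with
  | zero => simp
  | add u u' h h' => simp only [map_add, h, h']
  | tmul a θ =>
    have h1 : ∀ u : H ⊗[k] ΩH, coactTranslationLift S ℓ CH CA ΛL β
        ((TensorProduct.assoc k ΩA ΩH ΩH).symm (a ⊗ₜ LinearMap.rTensor ΩH CH.ι.toLinearMap u)) =
        LinearMap.mul' k ((ΩA ⊗[k] ΩH) ⊗[k] ΩA) (TensorProduct.map
          ((TensorProduct.mk k (ΩA ⊗[k] ΩH) ΩA).flip 1 ∘ₗ TensorProduct.mk k ΩA ΩH a ∘ₗ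
            CH.ι.toLinearMap) (coactTranslationAux S ℓ CH CA β) (LinearMap.lTensor H ΛL u)) := by
      intro u
      induction u with
      | zero => simp
      | add u u' h h' => simp only [map_add, tmul_add, h, h']
      | tmul h y => simp [coactTranslationLift]
    have h2 : ∀ u : H ⊗[k] ΩH, LinearMap.mul' k ((ΩA ⊗[k] ΩH) ⊗[k] ΩA) (TensorProduct.map
          ((TensorProduct.mk k (ΩA ⊗[k] ΩH) ΩA).flip 1 ∘ₗ TensorProduct.mk k ΩA ΩH a ∘ₗ
            CH.ι.toLinearMap) (coactTranslationAux S ℓ CH CA β)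
          (TensorProduct.assoc k H H ΩH (LinearMap.rTensor ΩH Coalgebra.comul u))) =
        LinearMap.rTensor ΩA ((TensorProduct.mk k ΩA ΩH).flip 1)
          ((a ⊗ₜ 1) * translationAux ℓ CA β u) := by
      intro u
      induction u with
      | zero => simp
      | add u u' h h' => simp only [map_add, mul_add, h, h']
      | tmul h y =>
        have h3 : ∀ v : H ⊗[k] H, LinearMap.mul' k ((ΩA ⊗[k] ΩH) ⊗[k] ΩA) (TensorProduct.map
            ((TensorProduct.mk k (ΩA ⊗[k] ΩH) ΩA).flip 1 ∘ₗ TensorProduct.mk k ΩA ΩH a ∘ₗ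
              CH.ι.toLinearMap) (coactTranslationAux S ℓ CH CA β)
            (TensorProduct.assoc k H H ΩH (v ⊗ₜ y))) =
          ((a ⊗ₜ 1) ⊗ₜ 1) * TensorProduct.map (TensorProduct.map CA.ι.toLinearMap
            CH.ι.toLinearMap) CA.ι.toLinearMap (LinearMap.mul' k ((A ⊗[k] H) ⊗[k] A)
              (TensorProduct.map ((TensorProduct.mk k (A ⊗[k] H) A).flip 1 ∘ₗ
                TensorProduct.mk k A H 1) (LinearMap.rTensor A S.ρ.toLinearMap ∘ₗ ℓ) v)) *
            (1 ⊗ₜ β y) := by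
          intro v
          induction v with
          | zero => simp
          | add u u' h h' => simp only [map_add, add_tmul, mul_add, add_mul, h, h']
          | tmul p q =>
            simp only [TensorProduct.assoc_tmul, TensorProduct.map_tmul, LinearMap.comp_apply,
              LinearMap.mul'_apply, rTensor_map_ι_ι, coactTranslationAux, LinearMap.flip_apply,
              TensorProduct.mk_apply, AlgHom.toLinearMap_apply, map_one, ← mul_assoc]
            simp only [Algebra.TensorProduct.tmul_mul_tmul, mul_one, one_mul]
        rw [LinearMap.rTensor_tmul, h3, hℓ.mul_rTensor_ρ, translationAux_tmul]
        induction ℓ h with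
        | zero => simp
        | add u u' h h' => simp only [map_add, mul_add, add_mul, h, h']
        | tmul p q => simp
    rw [LinearMap.lTensor_tmul, LinearMap.comp_apply, h1, hΛ.coassoc, h2]
    rfl

end Descent

section Field

variable {k : Type*} [Field k] {H : Type*} [Ring H] [HopfAlgebra k H]
variable {A : Type*} [Ring A] [Algebra k A] {S : ComodAlg k H A} {ℓ : H →ₗ[k] A ⊗[k] A}
variable {ΩH : Type*} [Ring ΩH] [Algebra k ΩH] {CH : DiffCalc k H ΩH}
variable {ΩA : Type*} [Ring ΩA] [Algebra k ΩA] {CA : DiffCalc k A ΩA}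
variable {ΛL : ΩH →ₗ[k] H ⊗[k] ΩH} {D : ΩA →ₗ[k] ΩA ⊗[k] ΩH}

lemma mem_range_rTensor_baseForms {z : ΩA ⊗[k] ΩA}
    (hz : LinearMap.rTensor ΩA D z = LinearMap.rTensor ΩA ((TensorProduct.mk k ΩA ΩH).flip 1) z) :
    z ∈ LinearMap.range (LinearMap.rTensor ΩA (baseForms D).subtype) := by
  have hex : Function.Exact (baseForms D).subtype (D - (TensorProduct.mk k ΩA ΩH).flip 1) := by
    intro y
    rw [LinearMap.sub_apply, sub_eq_zero, Submodule.coe_subtype, Subtype.range_coe]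
    rfl
  refine (Module.Flat.rTensor_exact ΩA hex z).1 ?_
  rw [LinearMap.rTensor_sub, LinearMap.sub_apply, hz, sub_self]

lemma IsCompleteExt.translationLift_mem_range (hD : IsCompleteExt S CA CH D)
    {DH : ΩH →ₗ[k] ΩH ⊗[k] ΩH} (hDH : IsCompleteExtH CH DH) (hΛ : IsLeftCovariantH CH ΛL)
    (hℓ : IsStrongConnection S ℓ) (β : ΩH →ₗ[k] ΩA) {n : ℕ} {x : ΩA}
    (hx : D x ∈ degreeLT CH.toDGA ΩA (n + 1)) :
    translationLift ℓ CA ΛL β (LinearMap.lTensor ΩA (CH.projN n) (D x)) ∈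
      LinearMap.range (LinearMap.rTensor ΩA (baseForms D).subtype) := by
  refine mem_range_rTensor_baseForms ?_
  rw [hD.rTensor_translationLift, ← hℓ.coactTranslationLift_assoc_symm hΛ,
    ← hD.assoc_top hDH hΛ hx, LinearEquiv.symm_apply_apply]

end Field

section Final

variable {k : Type*} [CommRing k] {H : Type*} [Ring H] [HopfAlgebra k H]
variable {A : Type*} [Ring A] [Algebra k A] {S : ComodAlg k H A} {ℓ : H →ₗ[k] A ⊗[k] A}
variable {ΩH : Type*} [Ring ΩH] [Algebra k ΩH] {CH : DiffCalc k H ΩH}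
variable {ΩA : Type*} [Ring ΩA] [Algebra k ΩA] {CA : DiffCalc k A ΩA}
variable {ΛL : ΩH →ₗ[k] H ⊗[k] ΩH} {D : ΩA →ₗ[k] ΩA ⊗[k] ΩH}

lemma IsCompleteExt.map_mul_of_mem_range (hD : IsCompleteExt S CA CH D) {z : ΩA ⊗[k] ΩA}
    (hz : z ∈ LinearMap.range (LinearMap.rTensor ΩA (baseForms D).subtype)) :
    D (LinearMap.mul' k ΩA z) = chiBulAux D z := by
  obtain ⟨u, rfl⟩ := hz
  induction u with
  | zero => simp
  | add u u' h h' => simp only [map_add, h, h']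
  | tmul b y =>
    rw [LinearMap.rTensor_tmul, LinearMap.mul'_apply, chiBulAux_tmul]
    exact hD.baseForms_mul b.2 y

lemma mul_sub_tmul_mul_mem_balRel {B : Submodule k ΩA} {z : ΩA ⊗[k] ΩA}
    (hz : z ∈ LinearMap.range (LinearMap.rTensor ΩA B.subtype)) (ω : ΩA) :
    (ω ⊗ₜ 1) * z - ω ⊗ₜ LinearMap.mul' k ΩA z ∈ balRel B := by
  obtain ⟨u, rfl⟩ := hz
  induction u with
  | zero => simp
  | add u u' h h' =>
    simp only [map_add, mul_add, tmul_add, add_sub_add_comm]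
    exact add_mem h h'
  | tmul b y => exact Submodule.subset_span ⟨ω, y, b, by simp⟩

lemma translationLift_tmul_one_mul (β : ΩH →ₗ[k] ΩA) (ω : ΩA) (t : ΩA ⊗[k] ΩH) :
    translationLift ℓ CA ΛL β ((ω ⊗ₜ 1) * t) = (ω ⊗ₜ 1) * translationLift ℓ CA ΛL β t := by
  induction t with
  | zero => simp
  | add u u' h h' => simp only [map_add, mul_add, h, h']
  | tmul a θ =>
    rw [Algebra.TensorProduct.tmul_mul_tmul, one_mul, translationLift_tmul, translationLift_tmul,
      ← mul_assoc, Algebra.TensorProduct.tmul_mul_tmul, mul_one]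

end Final

section Field

variable {k : Type*} [Field k] {H : Type*} [Ring H] [HopfAlgebra k H]
variable {A : Type*} [Ring A] [Algebra k A] {S : ComodAlg k H A} {ℓ : H →ₗ[k] A ⊗[k] A}
variable {ΩH : Type*} [Ring ΩH] [Algebra k ΩH] {CH : DiffCalc k H ΩH}
variable {ΩA : Type*} [Ring ΩA] [Algebra k ΩA] {CA : DiffCalc k A ΩA}
variable {ΛL : ΩH →ₗ[k] H ⊗[k] ΩH} {D : ΩA →ₗ[k] ΩA ⊗[k] ΩH}

lemma IsCompleteExt.exists_translationLift (hD : IsCompleteExt S CA CH D)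
    {DH : ΩH →ₗ[k] ΩH ⊗[k] ΩH} (hDH : IsCompleteExtH CH DH) (hΛ : IsLeftCovariantH CH ΛL)
    (hℓ : IsStrongConnection S ℓ) {β : ΩH →ₗ[k] ΩA}
    (hβ : ∀ n, ∀ x ∈ CH.grading n, D (β x) - 1 ⊗ₜ piLam CH ΛL x ∈ degreeLT CH.toDGA ΩA n)
    (z : ΩA ⊗[k] ΩA) :
    ∃ s, z - translationLift ℓ CA ΛL β s ∈ balRel (baseForms D) := by
  have key : ∀ n y, D y ∈ degreeLT CH.toDGA ΩA n →
      ∃ s, ∀ ω, ω ⊗ₜ y - translationLift ℓ CA ΛL β ((ω ⊗ₜ 1) * s) ∈ balRel (baseForms D) := by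
    intro n
    induction n with
    | zero =>
      intro y hy
      have : y = 0 := hD.injective (by rw [eq_zero_of_mem_degreeLT_zero hy, map_zero])
      exact ⟨0, by simp [this]⟩
    | succ n ih =>
      intro y hy
      set t := LinearMap.lTensor ΩA (CH.projN n) (D y) with ht
      have hmem := hD.translationLift_mem_range hDH hΛ hℓ β hy
      rw [← ht] at hmem
      have ht' : t ∈ degreeLT CH.toDGA ΩA (n + 1) :=
        lTensor_projN_mem_degreeLT (Nat.lt_succ_self n) _
      obtain ⟨s, hs⟩ := ih (y - LinearMap.mul' k ΩA (translationLift ℓ CA ΛL β t)) (by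
        rw [map_sub, hD.map_mul_of_mem_range hmem, ← sub_sub_sub_cancel_right _ _ t]
        exact sub_mem (sub_lTensor_projN_mem_degreeLT hy)
          (hD.chiBulAux_translationLift_sub_mem hΛ hℓ hβ n ht'))
      refine ⟨s + t, fun ω => ?_⟩
      have := sub_mem (hs ω) (mul_sub_tmul_mul_mem_balRel hmem ω)
      rw [mul_add, map_add, translationLift_tmul_one_mul β ω t]
      rw [tmul_sub] at this
      convert this using 1
      abel
  induction z with
  | zero => exact ⟨0, by simp⟩
  | add z z' h h' =>
    obtain ⟨s, hs⟩ := h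
    obtain ⟨s', hs'⟩ := h'
    exact ⟨s + s', by rw [map_add, add_sub_add_comm]; exact add_mem hs hs'⟩
  | tmul ω y =>
    obtain ⟨n, hn⟩ := exists_mem_degreeLT (C := CH.toDGA) (D y)
    obtain ⟨s, hs⟩ := key n y hn
    exact ⟨_, hs ω⟩

lemma IsCompleteExt.surjective_and_ker_eq (hD : IsCompleteExt S CA CH D)
    {DH : ΩH →ₗ[k] ΩH ⊗[k] ΩH} (hDH : IsCompleteExtH CH DH) (hΛ : IsLeftCovariantH CH ΛL)
    (hℓ : IsStrongConnection S ℓ) :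
    Function.Surjective (chiBulAux D) ∧ LinearMap.ker (chiBulAux D) = balRel (baseForms D) := by
  obtain ⟨β, hβ⟩ := CH.exists_linearMap_of_forall_mem (TensorProduct.mk k ΩA ΩH 1 ∘ₗ piLam CH ΛL) D
    (degreeLT CH.toDGA ΩA) fun n x hx => hD.one_tmul_piLam_mem hΛ hℓ hx
  have hbij := bijective_of_sub_mem_degreeLT (C := CH.toDGA)
    (chiBulAux D ∘ₗ translationLift ℓ CA ΛL β)
    fun n s hs => hD.chiBulAux_translationLift_sub_mem hΛ hℓ hβ n hs
  refine ⟨fun s => ?_, le_antisymm (fun z hz => ?_) hD.balRel_le_ker⟩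
  · obtain ⟨t, ht⟩ := hbij.2 s
    exact ⟨_, ht⟩
  · obtain ⟨s, hs⟩ := hD.exists_translationLift hDH hΛ hℓ hβ z
    have h1 := hD.balRel_le_ker hs
    rw [LinearMap.mem_ker, map_sub, LinearMap.mem_ker.1 hz, zero_sub, neg_eq_zero] at h1
    have : s = 0 := hbij.1 (by rw [LinearMap.comp_apply, h1, map_zero])
    rwa [this, map_zero, sub_zero] at hs

end Field

section Grading

variable {k : Type*} [CommRing k]
variable {M N : Type*} [AddCommGroup M] [Module k M] [AddCommGroup N] [Module k N]

lemma tmul_mem_tensorGrading {𝒜 : ℕ → Submodule k M} {ℬ : ℕ → Submodule k N} {i j : ℕ} {x : M}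
    {y : N} (hx : x ∈ 𝒜 i) (hy : y ∈ ℬ j) : x ⊗ₜ[k] y ∈ tensorGrading 𝒜 ℬ (i + j) :=
  Submodule.mem_iSup_of_mem ⟨(i, j), rfl⟩ ⟨⟨x, hx⟩ ⊗ₜ ⟨y, hy⟩, rfl⟩

lemma tensorGrading_le {𝒜 : ℕ → Submodule k M} {ℬ : ℕ → Submodule k N} {n : ℕ}
    {P : Submodule k (M ⊗[k] N)}
    (h : ∀ i j, i + j = n → ∀ x ∈ 𝒜 i, ∀ y ∈ ℬ j, x ⊗ₜ y ∈ P) : tensorGrading 𝒜 ℬ n ≤ P := by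
  refine iSup_le ?_
  rintro ⟨⟨i, j⟩, hij⟩ _ ⟨u, rfl⟩
  induction u with
  | zero => simp
  | add u u' h h' => rw [map_add]; exact add_mem h h'
  | tmul x y => exact h i j hij x x.2 y y.2

variable {Ω : Type*} [Ring Ω] [Algebra k Ω] {Ξ : Type*} [Ring Ξ] [Algebra k Ξ]
variable (C : DGA k Ω) (C' : DGA k Ξ)

/-- Projection of `Ω ⊗ Ξ` onto the component of total degree `n`. -/
def totalProjN (n : ℕ) : Ω ⊗[k] Ξ →ₗ[k] Ω ⊗[k] Ξ :=
  ∑ p ∈ Finset.HasAntidiagonal.antidiagonal n, TensorProduct.map (C.projN p.1) (C'.projN p.2)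

lemma totalProjN_mem (n : ℕ) (t : Ω ⊗[k] Ξ) :
    totalProjN C C' n t ∈ tensorGrading C.grading C'.grading n := by
  rw [totalProjN, LinearMap.sum_apply]
  refine sum_mem fun p hp => ?_
  induction t with
  | zero => simp
  | add t t' h h' => rw [map_add]; exact add_mem h h'
  | tmul x y =>
    rw [← Finset.HasAntidiagonal.mem_antidiagonal.1 hp]
    exact tmul_mem_tensorGrading (C.projN_mem _ _) (C'.projN_mem _ _)

lemma totalProjN_tmul {i j : ℕ} {x : Ω} {y : Ξ} (hx : x ∈ C.grading i) (hy : y ∈ C'.grading j)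
    (n : ℕ) : totalProjN C C' n (x ⊗ₜ y) = if i + j = n then x ⊗ₜ y else 0 := by
  rw [totalProjN, LinearMap.sum_apply]
  have h0 : ∀ p : ℕ × ℕ, p ≠ (i, j) →
      TensorProduct.map (C.projN p.1) (C'.projN p.2) (x ⊗ₜ y) = 0 := by
    intro p hp
    rw [TensorProduct.map_tmul]
    by_cases hi : i = p.1
    · rw [C'.projN_of_mem_ne hy (fun hj => hp (Prod.ext hi.symm hj.symm)), tmul_zero]
    · rw [C.projN_of_mem_ne hx hi, zero_tmul]
  split_ifs with h
  · rw [Finset.sum_eq_single_of_mem (i, j) (Finset.HasAntidiagonal.mem_antidiagonal.2 h) fun p _ hp => h0 p hp,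
      TensorProduct.map_tmul, C.projN_of_mem hx, C'.projN_of_mem hy]
  · exact Finset.sum_eq_zero fun p hp => h0 p fun hp' =>
      h (by rw [← Finset.HasAntidiagonal.mem_antidiagonal.1 hp, hp'])

lemma totalProjN_of_mem {m : ℕ} {t : Ω ⊗[k] Ξ} (ht : t ∈ tensorGrading C.grading C'.grading m)
    (n : ℕ) : totalProjN C C' n t = if m = n then t else 0 := by
  have : tensorGrading C.grading C'.grading m ≤ LinearMap.ker
      (totalProjN C C' n - if m = n then LinearMap.id else 0) :=
    tensorGrading_le fun i j hij x hx y hy => by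
      rw [LinearMap.mem_ker, LinearMap.sub_apply, totalProjN_tmul C C' hx hy, hij]
      split_ifs <;> simp
  have := this ht
  rw [LinearMap.mem_ker, LinearMap.sub_apply, sub_eq_zero] at this
  rw [this]
  split_ifs <;> rfl

end Grading

section Canonical

variable {k : Type*} [CommRing k] {H : Type*} [Ring H] [HopfAlgebra k H]
variable {A : Type*} [Ring A] [Algebra k A] {S : ComodAlg k H A}
variable {ΩH : Type*} [Ring ΩH] [Algebra k ΩH] {CH : DiffCalc k H ΩH}
variable {ΩA : Type*} [Ring ΩA] [Algebra k ΩA] {CA : DiffCalc k A ΩA}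
variable {D : ΩA →ₗ[k] ΩA ⊗[k] ΩH}

lemma IsCompleteExt.chiBulAux_tmul_mem (hD : IsCompleteExt S CA CH D) {i j : ℕ} {x y : ΩA}
    (hx : x ∈ CA.grading i) (hy : y ∈ CA.grading j) :
    chiBulAux D (x ⊗ₜ y) ∈ tensorGrading CA.grading CH.grading (i + j) := by
  have : tensorGrading CA.grading CH.grading j ≤
      (tensorGrading CA.grading CH.grading (i + j)).comap (LinearMap.mulLeft k (x ⊗ₜ 1)) :=
    tensorGrading_le fun p q hpq y hy θ hθ => by
      rw [Submodule.mem_comap, LinearMap.mulLeft_apply, Algebra.TensorProduct.tmul_mul_tmul,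
        one_mul, ← hpq, ← add_assoc]
      exact tmul_mem_tensorGrading (CA.mul_mem hx hy) hθ
  rw [chiBulAux_tmul]
  exact this (hD.2.2.2.2 j y hy)

lemma IsCompleteExt.chiBulAux_totalProjN (hD : IsCompleteExt S CA CH D) (n : ℕ) (z : ΩA ⊗[k] ΩA) :
    chiBulAux D (totalProjN CA.toDGA CA.toDGA n z) =
      totalProjN CA.toDGA CH.toDGA n (chiBulAux D z) := by
  induction z with
  | zero => simp
  | add z z' h h' => simp only [map_add, h, h']
  | tmul x y =>
    induction x using CA.homogeneous_induction with
    | zero => simp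
    | add x x' h h' => simp only [add_tmul, map_add, h, h']
    | hom i x hx =>
      induction y using CA.homogeneous_induction with
      | zero => simp
      | add x x' h h' => simp only [tmul_add, map_add, h, h']
      | hom j y hy =>
        rw [totalProjN_tmul _ _ hx hy, totalProjN_of_mem _ _ (hD.chiBulAux_tmul_mem hx hy)]
        split_ifs
        · rfl
        · rw [map_zero]

lemma IsCompleteExt.exists_mem_tensorGrading (hD : IsCompleteExt S CA CH D)
    (hsurj : Function.Surjective (chiBulAux D)) {n : ℕ} {θ : ΩH} (hθ : θ ∈ CH.grading n) :
    ∃ z ∈ tensorGrading CA.grading CA.grading n, chiBulAux D z = 1 ⊗ₜ θ := by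
  obtain ⟨z, hz⟩ := hsurj (1 ⊗ₜ θ)
  refine ⟨_, totalProjN_mem CA.toDGA CA.toDGA n z, ?_⟩
  rw [hD.chiBulAux_totalProjN, hz, totalProjN_tmul _ _ CA.one_mem hθ, if_pos (zero_add n)]

variable (CA) in
/-- `w ⊗ v ↦ d(v⟨1⟩) w⟨1⟩ ⊗ w⟨2⟩ v⟨2⟩ + v⟨1⟩ w⟨1⟩ ⊗ w⟨2⟩ d(v⟨2⟩)`, before passing to the balanced
tensor product. -/
def tauOneAux : (A ⊗[k] A) ⊗[k] (A ⊗[k] A) →ₗ[k] ΩA ⊗[k] ΩA :=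
  (TensorProduct.map
      (LinearMap.mul' k ΩA ∘ₗ
        TensorProduct.map (CA.d ∘ₗ CA.ι.toLinearMap) CA.ι.toLinearMap ∘ₗ
        (TensorProduct.comm k A A).toLinearMap)
      (LinearMap.mul' k ΩA ∘ₗ TensorProduct.map CA.ι.toLinearMap CA.ι.toLinearMap) +
    TensorProduct.map
      (LinearMap.mul' k ΩA ∘ₗ
        TensorProduct.map CA.ι.toLinearMap CA.ι.toLinearMap ∘ₗ
        (TensorProduct.comm k A A).toLinearMap)
      (LinearMap.mul' k ΩA ∘ₗ
        TensorProduct.map CA.ι.toLinearMap (CA.d ∘ₗ CA.ι.toLinearMap))) ∘ₗ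
    (TensorProduct.tensorTensorTensorComm k A A A A).toLinearMap

lemma tauOneFormula_apply (CA : DiffCalc k A ΩA) (D : ΩA →ₗ[k] ΩA ⊗[k] ΩH)
    (x : (A ⊗[k] A) ⊗[k] (A ⊗[k] A)) :
    tauOneFormula CA D x = (balRel (baseForms D)).mkQ (tauOneAux CA x) := rfl

lemma tauOneAux_tmul (w : A ⊗[k] A) (b b' : A) :
    tauOneAux CA (w ⊗ₜ (b ⊗ₜ b')) =
      (CA.d (CA.ι b) ⊗ₜ 1) *
          (TensorProduct.map CA.ι.toLinearMap CA.ι.toLinearMap w * (1 ⊗ₜ CA.ι b')) +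
        (CA.ι b ⊗ₜ 1) *
          (TensorProduct.map CA.ι.toLinearMap CA.ι.toLinearMap w * (1 ⊗ₜ CA.d (CA.ι b'))) := by
  induction w with
  | zero => simp
  | add w w' h h' =>
    simp only [add_tmul, map_add, add_mul, mul_add, h, h']
    abel
  | tmul a a' => simp [tauOneAux]

lemma DiffCalc.d_ι_mul (CA : DiffCalc k A ΩA) (a b : A) :
    CA.d (CA.ι (a * b)) = CA.d (CA.ι a) * CA.ι b + CA.ι a * CA.d (CA.ι b) := by
  rw [map_mul, CA.leibniz 0 _ (CA.ι_mem a), pow_zero, one_smul]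

lemma DiffCalc.d_one (CA : DiffCalc k A ΩA) : CA.d 1 = 0 := by
  simpa using CA.d_ι_mul 1 1

lemma IsCompleteExt.tmul_mul_add (hD : IsCompleteExt S CA CH D) (b b' : A) :
    (CA.d (CA.ι b) ⊗ₜ 1) * D (CA.ι b') + (CA.ι b ⊗ₜ 1) * D (CA.d (CA.ι b')) =
      TensorProduct.map (CA.d ∘ₗ CA.ι.toLinearMap) CH.ι.toLinearMap (chiAux S (b ⊗ₜ b')) +
        TensorProduct.map CA.ι.toLinearMap (CH.d ∘ₗ CH.ι.toLinearMap) (chiAux S (b ⊗ₜ b')) := by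
  rw [hD.map_ι, hD.map_d_ι, chiAux_tmul]
  induction S.ρ b' with
  | zero => simp
  | add t t' h h' =>
    simp only [map_add, mul_add] at h h' ⊢
    rw [add_add_add_comm _ _ _ (TensorProduct.map _ _ (_ * t')), ← h, ← h']
    abel
  | tmul a h =>
    simp only [TensorProduct.map_tmul, Algebra.TensorProduct.tmul_mul_tmul, one_mul, mul_add,
      LinearMap.comp_apply, AlgHom.toLinearMap_apply]
    rw [CA.d_ι_mul, add_tmul, map_mul, add_assoc]

lemma IsCompleteExt.chiBulAux_tauOneAux (hD : IsCompleteExt S CA CH D) {h : H} {w : A ⊗[k] A}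
    (hw : chiAux S w = 1 ⊗ₜ h) (v : A ⊗[k] A) :
    chiBulAux D (tauOneAux CA (w ⊗ₜ v)) =
      (1 ⊗ₜ CH.ι h) *
        (TensorProduct.map (CA.d ∘ₗ CA.ι.toLinearMap) CH.ι.toLinearMap (chiAux S v) +
          TensorProduct.map CA.ι.toLinearMap (CH.d ∘ₗ CH.ι.toLinearMap) (chiAux S v)) := by
  induction v with
  | zero => simp
  | add v v' h h' =>
    simp only [tmul_add, map_add, h, h', mul_add]
    abel
  | tmul b b' =>
    rw [← hD.tmul_mul_add, tauOneAux_tmul, map_add, chiBulAux_tmul_one_mul, chiBulAux_tmul_one_mul,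
      hD.chiBulAux_map_ι_mul, hD.chiBulAux_map_ι_mul, hw, mul_add]
    simp [← mul_assoc]

end Canonical

/-- For a complete calculus on a quantum principal bundle,
`Ω•(B) = Ω•(A)^{co Ω•(H)} ⊆ Ω•(A)` is a graded Hopf–Galois extension: there
is a graded extension `τ•` of the translation map (agreeing with `τ` in
degree `0` and given by the stated formula in degree `1`) such that the
graded canonical map `χ• : Ω•(A) ⊗_{Ω•(B)} Ω•(A) → Ω•(A) ⊗ Ω•(H)`,
`ω ⊗ η ↦ ω ∧ η₍₀₎ ⊗ η₍₁₎`, is bijective with inverse `ω ⊗ θ ↦ ω ∧ τ•(θ)`. -/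
theorem graded_HopfGalois_extension
    {k : Type*} [Field k] {H : Type*} [Ring H] [HopfAlgebra k H]
    (hS : Function.Bijective (HopfAlgebra.antipode (R := k) (A := H)))
    {A : Type*} [Ring A] [Algebra k A] (S : ComodAlg k H A) (hQPB : S.IsQPB)
    {ΩH : Type*} [Ring ΩH] [Algebra k ΩH] (CH : DiffCalc k H ΩH)
    (ΔR : ΩH →ₗ[k] ΩH ⊗[k] H) (ΛL : ΩH →ₗ[k] H ⊗[k] ΩH)
    (hbicov : IsBicovariantH CH ΔR ΛL) (hmax : IsMaxProl (k := k) CH)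
    (DH : ΩH →ₗ[k] ΩH ⊗[k] ΩH) (hDH : IsCompleteExtH CH DH)
    {ΩA : Type*} [Ring ΩA] [Algebra k ΩA] (CA : DiffCalc k A ΩA)
    (DA : ΩA →ₗ[k] ΩA ⊗[k] ΩH) (hDA : IsCompleteExt S CA CH DA) :
    ∃ τb : ΩH →ₗ[k] TensorOver (k := k) (baseForms DA),
      -- `τ•` extends the translation map `τ` in degree zero ...
      (∀ (h : H) (w : A ⊗[k] A), chiAux S w = 1 ⊗ₜ[k] h →
        τb (CH.ι h) =
          ((balRel (baseForms DA)).mkQ ∘ₗ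
            TensorProduct.map CA.ι.toLinearMap CA.ι.toLinearMap) w) ∧
      -- ... is given in degree one by the stated formula ...
      (∀ (h g : H) (w v : A ⊗[k] A),
        chiAux S w = 1 ⊗ₜ[k] h → chiAux S v = 1 ⊗ₜ[k] g →
        τb (CH.ι h * CH.d (CH.ι g)) = tauOneFormula CA DA (w ⊗ₜ[k] v)) ∧
      -- ... and is graded
      (∀ n : ℕ, ∀ θ ∈ CH.grading n,
        τb θ ∈ Submodule.map (balRel (baseForms DA)).mkQ
          (tensorGrading CA.grading CA.grading n)) ∧
      -- the graded canonical map `χ•` is bijective ...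
      Function.Surjective (chiBulAux DA) ∧
      LinearMap.ker (chiBulAux DA) = balRel (baseForms DA) ∧
      -- ... with inverse `ω ⊗ θ ↦ ω ∧ τ•(θ)`
      (∀ (ω : ΩA) (θ : ΩH), ∃ z : ΩA ⊗[k] ΩA,
        (balRel (baseForms DA)).mkQ z = lmulQ (baseForms DA) ω (τb θ) ∧
        chiBulAux DA z = ω ⊗ₜ[k] θ) := by
  obtain ⟨ℓ, hℓ⟩ := hQPB.2
  obtain ⟨hsurj, hker⟩ := hDA.surjective_and_ker_eq hDH hbicov.2.1 hℓ
  let e : TensorOver (k := k) (baseForms DA) ≃ₗ[k] ΩA ⊗[k] ΩH :=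
    LinearEquiv.ofBijective (Submodule.liftQ _ (chiBulAux DA) hker.ge)
      ⟨LinearMap.ker_eq_bot.1 (Submodule.ker_liftQ_eq_bot _ _ _ hker.le), fun t =>
        let ⟨z, hz⟩ := hsurj t; ⟨(balRel (baseForms DA)).mkQ z, hz⟩⟩
  have hτ : ∀ (θ : ΩH) (z : ΩA ⊗[k] ΩA), chiBulAux DA z = 1 ⊗ₜ θ →
      (e.symm.toLinearMap ∘ₗ TensorProduct.mk k ΩA ΩH 1) θ = (balRel (baseForms DA)).mkQ z :=
    fun θ z hz => e.symm_apply_eq.2 hz.symm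
  refine ⟨e.symm.toLinearMap ∘ₗ TensorProduct.mk k ΩA ΩH 1, fun h w hw => hτ _ _ ?_,
    fun h g w v hw hv => ?_, fun n θ hθ => ?_, hsurj, hker, fun ω θ => ?_⟩
  · have := hDA.chiBulAux_map_ι_mul w 1
    rw [hw, hDA.1, ← Algebra.TensorProduct.one_def, ← Algebra.TensorProduct.one_def, mul_one,
      mul_one] at this
    simpa using this
  · rw [tauOneFormula_apply]
    refine hτ _ _ ?_
    rw [hDA.chiBulAux_tauOneAux hw, hv]
    simp [CA.d_one]
  · obtain ⟨z, hz, hzθ⟩ := hDA.exists_mem_tensorGrading hsurj hθ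
    exact ⟨z, hz, (hτ θ z hzθ).symm⟩
  · obtain ⟨z, hz⟩ := hsurj (1 ⊗ₜ θ)
    refine ⟨LinearMap.rTensor ΩA (LinearMap.mul k ΩA ω) z, ?_, ?_⟩
    · rw [hτ θ z hz]
      rfl
    · have : LinearMap.rTensor ΩA (LinearMap.mul k ΩA ω) z = (ω ⊗ₜ 1) * z := by
        clear hz
        induction z with
        | zero => simp
        | add z z' h h' => simp only [map_add, mul_add, h, h']
        | tmul x y => simp
      rw [this, chiBulAux_tmul_one_mul, hz, Algebra.TensorProduct.tmul_mul_tmul, mul_one, one_mul]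

end NCG
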